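/- arXiv:2210.12465 — 2 statements merged into one kernel-verified Lean document; each statement's English description precedes it below -/
import Mathlib

section
/- Let Π be an even-near-critical centrally symmetric allowable sequence of 2n points in noncentral general position with central signature (d₁, ..., dₜ), with first crossing switch in the first move. Then for each 1 ≤ k ≤ d₁, the path of the point s₁(k) through a halfperiod is: one central jump, then k-1 passive jumps, then n-d₁ right jumps, then 2(d₁-k)+1 passive jumps, then n-d₁ left jumps, then k-1 passive jumps. -/
/-- `σ` is obtained from `ρ` by reversing disjoint substrings of consecutive positions:
every position lies in an interval `[a,b]` of positions that gets reversed
(a trivial interval `a = b` accounts for untouched positions).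
Permutations send points to positions (`0`-indexed). -/
def IsIntervalReversalStep (N : ℕ) (ρ σ : Fin N ≃ Fin N) : Prop :=
  ∀ j : Fin N, ∃ a b : ℕ, a ≤ (j : ℕ) ∧ (j : ℕ) ≤ b ∧ b < N ∧
    ∀ p : Fin N, a ≤ ((ρ p : ℕ)) → ((ρ p : ℕ)) ≤ b → ((σ p : ℕ)) = a + b - ((ρ p : ℕ))

/-- An allowable sequence on `N` points: a doubly-infinite sequence of permutations
(point `p` occupies position `perm i p` in the `i`-th permutation), where
`perm (i + h)` is the reversal of `perm i`, consecutive permutations differ by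
simultaneous reversals of disjoint consecutive substrings, and every pair of points
switches (i.e. reverses its relative order) exactly once per halfperiod. -/
structure AllowableSeq (N : ℕ) where
  perm : ℤ → (Fin N ≃ Fin N)
  h : ℕ
  h_pos : 0 < h
  reversal : ∀ (i : ℤ) (p : Fin N), ((perm (i + h)) p : ℕ) = N - 1 - ((perm i) p : ℕ)
  step : ∀ i : ℤ, IsIntervalReversalStep N (perm (i - 1)) (perm i)
  flip_once : ∀ p q : Fin N, p ≠ q →
    ∃! i : ℤ, i ∈ Finset.Icc 1 (h : ℤ) ∧
      ¬ (((perm (i - 1)) p < (perm (i - 1)) q) ↔ ((perm i) p < (perm i) q))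

/-- The pair of points `p, q` switches (participates in a common switch) in the
`i`-th move, i.e. their relative order is reversed from `perm (i-1)` to `perm i`. -/
def Flips {N : ℕ} (A : AllowableSeq N) (i : ℤ) (p q : Fin N) : Prop :=
  ¬ (((A.perm (i - 1)) p < (A.perm (i - 1)) q) ↔ ((A.perm i) p < (A.perm i) q))

/-- `A` is centrally symmetric with conjugation `conj`: the positions of a point and
its conjugate always sum to `N - 1` (i.e. `2n + 1` with `1`-indexed positions). -/
def CentSym {N : ℕ} (A : AllowableSeq N) (conj : Fin N → Fin N) : Prop :=
  ∀ (i : ℤ) (p : Fin N), ((A.perm i) p : ℕ) + ((A.perm i) (conj p) : ℕ) = N - 1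

/-- The `i`-th move of `A` (an allowable sequence on `2n` points) contains a crossing
switch reversing a centered substring of `2d` points, occupying positions
`n - d, …, n + d - 1`; maximality of the reversed centered substring is required. -/
def CrossingAt (n : ℕ) (A : AllowableSeq (2 * n)) (i : ℤ) (d : ℕ) : Prop :=
  1 ≤ d ∧ d ≤ n ∧
  (∀ p : Fin (2 * n), n - d ≤ ((A.perm (i - 1)) p : ℕ) → ((A.perm (i - 1)) p : ℕ) < n + d →
      ((A.perm i) p : ℕ) = 2 * n - 1 - ((A.perm (i - 1)) p : ℕ)) ∧
  (d = n ∨ ∀ p : Fin (2 * n), ((A.perm (i - 1)) p : ℕ) = n - d - 1 →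
      ((A.perm i) p : ℕ) ≠ n + d)

/-- `A` has central signature `(d 0, …, d (t-1))`, witnessed by the strictly increasing
sequence `m 0 < ⋯ < m (t-1)` of moves of the halfperiod `1, …, 2n` containing the
crossing switches, the `i`-th reversing `2 * d i` points; no other move contains a
crossing switch. -/
def HasCentralSignature (n t : ℕ) (A : AllowableSeq (2 * n)) (d : Fin t → ℕ)
    (m : Fin t → ℤ) : Prop :=
  StrictMono m ∧ (∀ i, m i ∈ Finset.Icc (1 : ℤ) (2 * n)) ∧
  (∀ i, CrossingAt n A (m i) (d i)) ∧
  (∀ j : ℤ, j ∈ Finset.Icc (1 : ℤ) (2 * n) → (∀ i, j ≠ m i) → ∀ e, ¬ CrossingAt n A j e)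

/-- `A` is in noncentral general position: every switch other than a crossing switch is
a transposition, i.e. every point that moves in a move either moves by exactly one
position or takes part in the crossing switch of that move. -/
def NoncentralGenPos (n : ℕ) (A : AllowableSeq (2 * n)) : Prop :=
  ∀ (i : ℤ) (p : Fin (2 * n)), ((A.perm i) p : ℕ) ≠ ((A.perm (i - 1)) p : ℕ) →
    (((A.perm i) p : ℕ) + 1 = ((A.perm (i - 1)) p : ℕ) ∨
      ((A.perm (i - 1)) p : ℕ) + 1 = ((A.perm i) p : ℕ)) ∨
    ∃ e, CrossingAt n A i e ∧ n - e ≤ ((A.perm (i - 1)) p : ℕ) ∧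
      ((A.perm (i - 1)) p : ℕ) < n + e

/-- integer-valued position of the point `p` at time `i`. -/
def psn {N : ℕ} (A : AllowableSeq N) (i : ℤ) (p : Fin N) : ℤ := ((A.perm i p : ℕ) : ℤ)

lemma psn_nonneg {N : ℕ} (A : AllowableSeq N) (i : ℤ) (p : Fin N) : 0 ≤ psn A i p := by
  unfold psn; omega

lemma psn_lt {N : ℕ} (A : AllowableSeq N) (i : ℤ) (p : Fin N) : psn A i p < N := by
  unfold psn; have := (A.perm i p).isLt; omega

lemma psn_inj {N : ℕ} (A : AllowableSeq N) (i : ℤ) {p q : Fin N} (h : psn A i p = psn A i q) :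
    p = q := by
  unfold psn at h
  exact (A.perm i).injective (Fin.ext (by omega))

lemma psn_surj {N : ℕ} (A : AllowableSeq N) (i : ℤ) (x : ℤ) (h0 : 0 ≤ x) (h1 : x < N) :
    ∃ p, psn A i p = x := by
  obtain ⟨p, hp⟩ := (A.perm i).surjective ⟨x.toNat, by omega⟩
  refine ⟨p, ?_⟩
  unfold psn; rw [hp]; simp; omega

lemma flips_iff {N : ℕ} (A : AllowableSeq N) (i : ℤ) (p q : Fin N) :
    Flips A i p q ↔ ¬ (psn A (i-1) p < psn A (i-1) q ↔ psn A i p < psn A i q) := by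
  unfold Flips psn
  simp only [Fin.lt_def, Nat.cast_lt]

lemma psn_step {N : ℕ} (A : AllowableSeq N) (i : ℤ) (p : Fin N) :
    ∃ a b : ℤ, 0 ≤ a ∧ b < N ∧ a ≤ psn A (i-1) p ∧ psn A (i-1) p ≤ b ∧
      ∀ q, a ≤ psn A (i-1) q → psn A (i-1) q ≤ b → psn A i q = a + b - psn A (i-1) q := by
  obtain ⟨a, b, h1, h2, h3, h4⟩ := A.step i (A.perm (i-1) p)
  refine ⟨a, b, by omega, by omega, ?_, ?_, ?_⟩
  · unfold psn; omega
  · unfold psn; omega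
  · intro q hq hq'
    unfold psn at *
    have := h4 q (by omega) (by omega)
    omega

lemma flips_interval_aux {N : ℕ} (A : AllowableSeq N) (i : ℤ) (p q : Fin N)
    (hlt : psn A (i-1) p < psn A (i-1) q) (hgt : psn A i q < psn A i p) :
    ∃ a b : ℤ, 0 ≤ a ∧ b < N ∧ a ≤ psn A (i-1) p ∧ psn A (i-1) q ≤ b ∧
      ∀ q, a ≤ psn A (i-1) q → psn A (i-1) q ≤ b → psn A i q = a + b - psn A (i-1) q := by
  obtain ⟨a, b, h1, h2, h3, h4, h5⟩ := psn_step A i p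
  obtain ⟨a', b', h1', h2', h3', h4', h5'⟩ := psn_step A i q
  by_cases c1 : psn A (i-1) q ≤ b
  · exact ⟨a, b, h1, h2, h3, c1, h5⟩
  by_cases c2 : a' ≤ psn A (i-1) p
  · exact ⟨a', b', h1', h2', c2, h4', h5'⟩
  exfalso
  have e1 := h5 p h3 h4
  have e2 := h5' q h3' h4'
  by_cases c3 : b < a'
  · omega
  obtain ⟨r, hr⟩ := psn_surj A (i-1) b (by omega) h2
  have e3 := h5 r (by omega) (by omega)
  have e4 := h5' r (by omega) (by omega)
  omega

lemma flips_symm {N : ℕ} {A : AllowableSeq N} {i : ℤ} {p q : Fin N} (h : Flips A i p q) :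
    Flips A i q p := by
  rw [flips_iff] at *
  by_cases hpq : p = q
  · subst hpq; exact h
  have h1 : psn A (i-1) p ≠ psn A (i-1) q := fun h => hpq (psn_inj A _ h)
  have h2 : psn A i p ≠ psn A i q := fun h => hpq (psn_inj A _ h)
  omega

lemma flips_ne {N : ℕ} {A : AllowableSeq N} {i : ℤ} {p q : Fin N} (h : Flips A i p q) :
    p ≠ q := by
  rintro rfl
  rw [flips_iff] at h
  simp at h

/-- The point `p` takes part in a crossing switch in the `i`-th move. -/
def InCross (n : ℕ) (A : AllowableSeq (2 * n)) (i : ℤ) (p : Fin (2 * n)) : Prop :=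
  ∃ e : ℕ, CrossingAt n A i e ∧ (n : ℤ) - e ≤ psn A (i-1) p ∧ psn A (i-1) p < n + e

lemma cross_psn {n : ℕ} {A : AllowableSeq (2 * n)} {i : ℤ} {e : ℕ} (h : CrossingAt n A i e)
    (p : Fin (2*n)) (h1 : (n : ℤ) - e ≤ psn A (i-1) p) (h2 : psn A (i-1) p < n + e) :
    psn A i p = 2 * n - 1 - psn A (i-1) p := by
  obtain ⟨a, b, c, _⟩ := h
  unfold psn at *
  have := c p (by omega) (by omega)
  omega

lemma cross_flips {n : ℕ} {A : AllowableSeq (2 * n)} {i : ℤ} {e : ℕ} (h : CrossingAt n A i e)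
    {p q : Fin (2*n)} (h1 : (n : ℤ) - e ≤ psn A (i-1) p) (h2 : psn A (i-1) p < n + e)
    (h3 : (n : ℤ) - e ≤ psn A (i-1) q) (h4 : psn A (i-1) q < n + e) (hpq : p ≠ q) :
    Flips A i p q := by
  rw [flips_iff]
  have e1 := cross_psn h p h1 h2
  have e2 := cross_psn h q h3 h4
  have h1 : psn A (i-1) p ≠ psn A (i-1) q := fun h => hpq (psn_inj A _ h)
  omega

lemma psn_conj {n : ℕ} {A : AllowableSeq (2 * n)} {conj : Fin (2 * n) → Fin (2 * n)}
    (hcs : CentSym A conj) (i : ℤ) (p : Fin (2*n)) :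
    psn A i (conj p) = 2 * n - 1 - psn A i p := by
  have := hcs i p
  have := p.isLt
  unfold psn; omega

lemma inCross_flips {n : ℕ} {A : AllowableSeq (2 * n)} {conj : Fin (2 * n) → Fin (2 * n)}
    (hcs : CentSym A conj) {i : ℤ} {p : Fin (2*n)} (h : InCross n A i p) :
    Flips A i p (conj p) := by
  obtain ⟨e, h, h1, h2⟩ := h
  have hc := psn_conj hcs (i-1) p
  refine cross_flips h h1 h2 (by omega) (by omega) ?_
  intro hh
  rw [← hh] at hc
  omega

lemma psn_rev {n : ℕ} {A : AllowableSeq (2 * n)} (henc : A.h = 2 * n) (i : ℤ) (p : Fin (2*n)) :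
    psn A (i + 2 * n) p = 2 * n - 1 - psn A i p := by
  have := A.reversal i p
  have h3 := (A.perm i p).isLt
  rw [henc] at this
  push_cast at this
  unfold psn; omega

lemma flips_shift {n : ℕ} {A : AllowableSeq (2 * n)} (henc : A.h = 2 * n) (i : ℤ)
    (p q : Fin (2*n)) : Flips A (i + 2 * n) p q ↔ Flips A i p q := by
  by_cases hpq : p = q
  · subst hpq; simp [flips_iff]
  rw [flips_iff, flips_iff]
  have h1 : psn A (i-1) p ≠ psn A (i-1) q := fun h => hpq (psn_inj A _ h)
  have h2 : psn A i p ≠ psn A i q := fun h => hpq (psn_inj A _ h)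
  have e1 := psn_rev henc i p
  have e2 := psn_rev henc i q
  have e3 := psn_rev henc (i-1) p
  have e4 := psn_rev henc (i-1) q
  rw [show i + 2 * (n:ℤ) - 1 = i - 1 + 2 * n by ring]
  omega

lemma flips_shift_nat {n : ℕ} {A : AllowableSeq (2 * n)} (henc : A.h = 2 * n) (i : ℤ)
    (p q : Fin (2*n)) (c : ℕ) : Flips A (i + 2 * n * c) p q ↔ Flips A i p q := by
  induction c with
  | zero => simp
  | succ c ih =>
    rw [← ih, ← flips_shift henc (i + 2 * n * c)]
    push_cast
    rw [show i + 2 * (n:ℤ) * (c + 1) = i + 2 * n * c + 2 * n by ring]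

lemma flips_shift_int {n : ℕ} {A : AllowableSeq (2 * n)} (henc : A.h = 2 * n) (i : ℤ)
    (p q : Fin (2*n)) (c : ℤ) : Flips A (i + 2 * n * c) p q ↔ Flips A i p q := by
  obtain ⟨c, rfl | rfl⟩ := c.eq_nat_or_neg
  · exact flips_shift_nat henc i p q c
  · rw [← flips_shift_nat henc (i + 2 * n * (-(c:ℤ))) p q c]
    rw [show i + 2 * (n:ℤ) * (-(c:ℤ)) + 2 * n * c = i by ring]

lemma flips_unique {n : ℕ} {A : AllowableSeq (2 * n)} (hn : 0 < n) (henc : A.h = 2 * n)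
    {i j : ℤ} {p q : Fin (2*n)} (hi : Flips A i p q) (hj : Flips A j p q) (hij : i < j) :
    i + 2 * n ≤ j := by
  have hpos : (0:ℤ) < 2 * n := by omega
  have key : ∀ i, Flips A i p q → ∃ c r : ℤ, i = r + 2 * n * c ∧ 1 ≤ r ∧ r ≤ 2 * n ∧
      Flips A r p q := by
    intro i hi
    refine ⟨(i-1) / (2*n), (i-1) % (2*n) + 1, ?_, ?_, ?_, ?_⟩
    · have := Int.emod_add_mul_ediv (i-1) (2*n); linarith
    · have := Int.emod_nonneg (i-1) hpos.ne'; omega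
    · have := Int.emod_lt_of_pos (i-1) hpos; omega
    · rw [← flips_shift_int henc _ p q ((i-1) / (2*n))]
      have := Int.emod_add_mul_ediv (i-1) (2*n)
      convert hi using 1; linarith
  obtain ⟨c, r, h1, h2, h3, h4⟩ := key i hi
  obtain ⟨c', r', h1', h2', h3', h4'⟩ := key j hj
  obtain ⟨x, _, hx⟩ := A.flip_once p q (flips_ne hi)
  have e1 := hx r ⟨by rw [Finset.mem_Icc, henc]; push_cast; omega, h4⟩
  have e2 := hx r' ⟨by rw [Finset.mem_Icc, henc]; push_cast; omega, h4'⟩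
  have : r = r' := e1.trans e2.symm
  subst this
  have hc : c < c' := by nlinarith
  nlinarith

lemma flips_exists {n : ℕ} {A : AllowableSeq (2 * n)} (henc : A.h = 2 * n)
    {p q : Fin (2*n)} (hpq : p ≠ q) : ∃ i : ℤ, 1 ≤ i ∧ i ≤ 2 * n ∧ Flips A i p q := by
  obtain ⟨x, ⟨hx, hx'⟩, _⟩ := A.flip_once p q hpq
  rw [Finset.mem_Icc, henc] at hx
  push_cast at hx
  exact ⟨x, hx.1, hx.2, hx'⟩

lemma gen_psn {n : ℕ} {A : AllowableSeq (2 * n)} (hgen : NoncentralGenPos n A) (i : ℤ)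
    (p : Fin (2*n)) (h : psn A i p ≠ psn A (i-1) p) :
    InCross n A i p ∨ psn A i p = psn A (i-1) p + 1 ∨ psn A i p = psn A (i-1) p - 1 := by
  have := hgen i p (by unfold psn at h; omega)
  rcases this with h1 | ⟨e, h1, h2, h3⟩
  · right; unfold psn; omega
  · left; refine ⟨e, h1, ?_, ?_⟩ <;> unfold psn <;> have := h1.2.1 <;> omega

lemma flips_cases_aux {n : ℕ} {A : AllowableSeq (2 * n)} (hgen : NoncentralGenPos n A) {i : ℤ}
    {p q : Fin (2*n)} (hlt : psn A (i-1) p < psn A (i-1) q) (hgt : psn A i q < psn A i p) :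
    (∃ e : ℕ, CrossingAt n A i e ∧ (n : ℤ) - e ≤ psn A (i-1) p ∧ psn A (i-1) q < n + e) ∨
    (psn A i p = psn A (i-1) q ∧ psn A i q = psn A (i-1) p ∧
      psn A (i-1) q = psn A (i-1) p + 1) := by
  obtain ⟨a, b, h1, h2, h3, h4, h5⟩ := flips_interval_aux A i p q hlt hgt
  have e1 := h5 p h3 (by omega)
  have e2 := h5 q (by omega) h4
  by_cases hab : b = a + 1
  · right; omega
  · left
    obtain ⟨x, hx⟩ := psn_surj A (i-1) a (by omega) (by omega)
    have e3 := h5 x (by omega) (by omega)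
    rcases gen_psn hgen i x (by omega) with ⟨e, he, h6, h7⟩ | h6
    · have := cross_psn he x h6 h7
      exact ⟨e, he, by omega, by omega⟩
    · omega

lemma flips_cases {n : ℕ} {A : AllowableSeq (2 * n)} (hgen : NoncentralGenPos n A) {i : ℤ}
    {p q : Fin (2*n)} (h : Flips A i p q) :
    InCross n A i p ∨ (psn A i p = psn A (i-1) q ∧ psn A i q = psn A (i-1) p ∧
      (psn A (i-1) q = psn A (i-1) p + 1 ∨ psn A (i-1) q = psn A (i-1) p - 1)) := by
  have hpq := flips_ne h
  have h1 : psn A (i-1) p ≠ psn A (i-1) q := fun h => hpq (psn_inj A _ h)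
  have h2 : psn A i p ≠ psn A i q := fun h => hpq (psn_inj A _ h)
  rw [flips_iff] at h
  rcases lt_or_gt_of_ne h1 with hlt | hlt
  · rcases flips_cases_aux hgen hlt (by omega) with ⟨e, he, h3, h4⟩ | h3
    · exact Or.inl ⟨e, he, h3, by omega⟩
    · right; omega
  · rcases flips_cases_aux hgen hlt (by omega) with ⟨e, he, h3, h4⟩ | h3
    · exact Or.inl ⟨e, he, by omega, by omega⟩
    · right; omega

lemma move_cases {n : ℕ} {A : AllowableSeq (2 * n)} (hgen : NoncentralGenPos n A) {i : ℤ}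
    {p : Fin (2*n)} (h : psn A i p ≠ psn A (i-1) p) :
    InCross n A i p ∨ ∃ q, Flips A i p q ∧ psn A i p = psn A (i-1) q ∧
      psn A i q = psn A (i-1) p ∧
      (psn A i p = psn A (i-1) p + 1 ∨ psn A i p = psn A (i-1) p - 1) := by
  obtain ⟨a, b, h1, h2, h3, h4, h5⟩ := psn_step A i p
  have e1 := h5 p h3 h4
  obtain ⟨q, hq⟩ := psn_surj A (i-1) (psn A i p) (psn_nonneg _ _ _) (psn_lt _ _ _)
  have e2 := h5 q (by omega) (by omega)
  have hf : Flips A i p q := by rw [flips_iff]; omega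
  rcases flips_cases hgen hf with h6 | h6
  · exact Or.inl h6
  · exact Or.inr ⟨q, hf, by omega, by omega, by omega⟩

lemma cross_shift {n : ℕ} {A : AllowableSeq (2 * n)} (henc : A.h = 2 * n)
    {conj : Fin (2 * n) → Fin (2 * n)} (hcs : CentSym A conj) {i : ℤ} {e : ℕ}
    (h : CrossingAt n A i e) : CrossingAt n A (i + 2 * n) e := by
  have h0 := h
  obtain ⟨h1, h2, h3, h4⟩ := h
  refine ⟨h1, h2, ?_, ?_⟩
  · intro p hp hp'
    have e1 := psn_rev henc i p
    have e2 := psn_rev henc (i-1) p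
    rw [show i + 2 * (n:ℤ) - 1 = i - 1 + 2 * n by ring] at *
    have e3 := cross_psn h0 p
    unfold psn at *
    omega
  · refine h4.imp_right ?_
    intro h4 p hp hp'
    have e1 := psn_rev henc i p
    have e2 := psn_rev henc (i-1) p
    rw [show i + 2 * (n:ℤ) - 1 = i - 1 + 2 * n by ring] at *
    have e3 := psn_conj hcs i p
    have e4 := psn_conj hcs (i-1) p
    have := h4 (conj p)
    have := p.isLt
    unfold psn at *
    omega

lemma cross_unique_aux {n : ℕ} {A : AllowableSeq (2 * n)} {i : ℤ} {e e' : ℕ}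
    (h : CrossingAt n A i e) (h' : CrossingAt n A i e') : e' ≤ e := by
  by_contra hlt
  obtain ⟨h1, h2, h3, h4⟩ := h
  obtain ⟨h1', h2', h3', h4'⟩ := h'
  rcases h4 with h4 | h4
  · omega
  · obtain ⟨p, hp⟩ := psn_surj A (i-1) ((n - e - 1 : ℕ) : ℤ) (by omega) (by push_cast; omega)
    unfold psn at hp
    have a1 := h3' p (by omega) (by omega)
    have a2 := h4 p (by omega)
    omega

lemma cross_exists {n : ℕ} {A : AllowableSeq (2 * n)}
    {conj : Fin (2 * n) → Fin (2 * n)} (hcs : CentSym A conj) {i : ℤ} (hn : 0 < n)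
    (h : ∀ p : Fin (2 * n), n - 1 ≤ ((A.perm (i - 1)) p : ℕ) → ((A.perm (i - 1)) p : ℕ) < n + 1 →
      ((A.perm i) p : ℕ) = 2 * n - 1 - ((A.perm (i - 1)) p : ℕ)) : ∃ e, CrossingAt n A i e := by
  classical
  let P : ℕ → Prop := fun e => ∀ p : Fin (2 * n), n - e ≤ ((A.perm (i - 1)) p : ℕ) →
      ((A.perm (i - 1)) p : ℕ) < n + e →
      ((A.perm i) p : ℕ) = 2 * n - 1 - ((A.perm (i - 1)) p : ℕ)
  have hP : P (Nat.findGreatest P n) := Nat.findGreatest_spec (P := P) (m := 1) (by omega) h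
  have h1 : 1 ≤ Nat.findGreatest P n := Nat.le_findGreatest (P := P) (by omega) h
  have h2 : Nat.findGreatest P n ≤ n := Nat.findGreatest_le n
  have h3 : ∀ k, Nat.findGreatest P n < k → k ≤ n → ¬ P k := 
    fun k a b => Nat.findGreatest_is_greatest a b
  generalize Nat.findGreatest P n = e at *
  refine ⟨e, h1, h2, hP, ?_⟩
  by_cases hen : e = n
  · exact Or.inl hen
  right
  intro p hp hp'
  apply h3 (e+1) (by omega) (by omega)
  intro q hq hq'
  by_cases c1 : psn A (i-1) q = psn A (i-1) p
  · have := psn_inj A _ c1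
    subst this
    omega
  by_cases c2 : psn A (i-1) q = psn A (i-1) (conj p)
  · have := psn_inj A _ c2
    subst this
    have e3 := psn_conj hcs i p
    have e4 := psn_conj hcs (i-1) p
    unfold psn at *
    omega
  · have e4 := psn_conj hcs (i-1) p
    unfold psn at *
    exact hP q (by omega) (by omega)

lemma cross_back {n : ℕ} {A : AllowableSeq (2 * n)} {i : ℤ} {e : ℕ} (h : CrossingAt n A i e)
    (p : Fin (2*n)) (h1 : (n : ℤ) - e ≤ psn A i p) (h2 : psn A i p < n + e) :
    psn A (i-1) p = 2 * n - 1 - psn A i p := by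
  have hn := h.2.1
  obtain ⟨r, hr⟩ := psn_surj A (i-1) (2 * n - 1 - psn A i p) (by omega) (by push_cast; omega)
  have := cross_psn h r (by omega) (by omega)
  have : r = p := psn_inj A i (by omega)
  subst this
  exact hr

lemma run_forward {n : ℕ} {A : AllowableSeq (2 * n)} (hn : 0 < n) (henc : A.h = 2 * n)
    {conj : Fin (2 * n) → Fin (2 * n)} (hcs : CentSym A conj) (hgen : NoncentralGenPos n A)
    {M : ℤ} {e : ℕ} (h : CrossingAt n A M e) (j : ℕ) :
    ∀ (x : ℤ) (p : Fin (2*n)), 0 ≤ x → x + j ≤ e - 1 → psn A M p = n + x →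
      psn A (M + j) p = n + x := by
  have hen := h.2.1
  induction j with
  | zero => intro x p _ _ h; simpa using h
  | succ j ih =>
    intro x p hx hxj hp
    push_cast at *
    have b1 := cross_back h p (by omega) (by omega)
    have e1 := ih x p hx (by omega) hp
    have hfc : Flips A M p (conj p) := inCross_flips hcs ⟨e, h, by omega, by omega⟩
    by_contra hne
    have hs : M + (j + 1 : ℤ) - 1 = M + j := by ring
    have hmv := move_cases (i := M + (j + 1)) (p := p) hgen (by rw [hs]; omega)
    rw [hs] at hmv
    rcases hmv with hc | ⟨q, hq, h1, h2, h3⟩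
    · have := flips_unique hn henc hfc (inCross_flips hcs hc) (by omega)
      omega
    · have hMq : Flips A M p q := by
        rcases h3 with h3 | h3
        · obtain ⟨r, hr⟩ := psn_surj A M (n + (x + 1)) (by omega) (by push_cast; omega)
          have e2 := ih (x+1) r (by omega) (by omega) hr
          have : r = q := psn_inj A (M + j) (by omega)
          subst this
          have b2 := cross_back h r (by omega) (by omega)
          exact cross_flips h (by omega) (by omega) (by omega) (by omega) (flips_ne hq)
        · by_cases hx0 : x = 0
          · have hc := psn_conj hcs (M+j) p
            have : conj p = q := psn_inj A (M + j) (by omega)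
            rw [← this]; exact hfc
          · obtain ⟨r, hr⟩ := psn_surj A M (n + (x - 1)) (by omega) (by push_cast; omega)
            have e2 := ih (x-1) r (by omega) (by omega) hr
            have : r = q := psn_inj A (M + j) (by omega)
            subst this
            have b2 := cross_back h r (by omega) (by omega)
            exact cross_flips h (by omega) (by omega) (by omega) (by omega) (flips_ne hq)
      have := flips_unique hn henc hMq hq (by omega)
      omega

lemma run_backward {n : ℕ} {A : AllowableSeq (2 * n)} (hn : 0 < n) (henc : A.h = 2 * n)
    {conj : Fin (2 * n) → Fin (2 * n)} (hcs : CentSym A conj) (hgen : NoncentralGenPos n A)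
    {M : ℤ} {e : ℕ} (h : CrossingAt n A M e) (j : ℕ) :
    ∀ (x : ℤ) (p : Fin (2*n)), 0 ≤ x → x + j ≤ e - 1 → psn A (M-1) p = n + x →
      psn A (M - 1 - j) p = n + x := by
  have hen := h.2.1
  induction j with
  | zero => intro x p _ _ h; simpa using h
  | succ j ih =>
    intro x p hx hxj hp
    push_cast at *
    have e1 := ih x p hx (by omega) hp
    have hfc : Flips A M p (conj p) := inCross_flips hcs ⟨e, h, by omega, by omega⟩
    by_contra hne
    have hs : M - 1 - (j + 1 : ℤ) = M - 1 - j - 1 := by ring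
    rw [hs] at hne
    have hmv := move_cases (i := M - 1 - j) (p := p) hgen (by omega)
    rcases hmv with hc | ⟨q, hq, h1, h2, h3⟩
    · have := flips_unique hn henc (inCross_flips hcs hc) hfc (by omega)
      omega
    · have hMq : Flips A M p q := by
        rcases h3 with h3 | h3
        · by_cases hx0 : x = 0
          · have hc := psn_conj hcs (M-1-j) p
            have : conj p = q := psn_inj A (M-1- j) (by omega)
            rw [← this]; exact hfc
          · obtain ⟨r, hr⟩ := psn_surj A (M-1) (n + (x - 1)) (by omega) (by push_cast; omega)
            have e2 := ih (x-1) r (by omega) (by omega) hr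
            have : r = q := psn_inj A (M -1 - j) (by omega)
            subst this
            exact cross_flips h (by omega) (by omega) (by omega) (by omega) (flips_ne hq)
        · obtain ⟨r, hr⟩ := psn_surj A (M-1) (n + (x + 1)) (by omega) (by push_cast; omega)
          have e2 := ih (x+1) r (by omega) (by omega) hr
          have : r = q := psn_inj A (M -1- j) (by omega)
          subst this
          exact cross_flips h (by omega) (by omega) (by omega) (by omega) (flips_ne hq)
      have := flips_unique hn henc hq hMq (by omega)
      omega

lemma run_forward' {n : ℕ} {A : AllowableSeq (2 * n)} (hn : 0 < n) (henc : A.h = 2 * n)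
    {conj : Fin (2 * n) → Fin (2 * n)} (hcs : CentSym A conj) (hgen : NoncentralGenPos n A)
    {M : ℤ} {e : ℕ} (h : CrossingAt n A M e) (T x : ℤ) (p : Fin (2*n)) (hT : M ≤ T) (hx : 0 ≤ x)
    (hxT : x + (T - M) ≤ e - 1) (hp : psn A M p = n + x) : psn A T p = n + x := by
  have := run_forward hn henc hcs hgen h (T - M).toNat x p hx (by omega) hp
  rwa [show M + ((T - M).toNat : ℤ) = T by omega] at this

lemma run_backward' {n : ℕ} {A : AllowableSeq (2 * n)} (hn : 0 < n) (henc : A.h = 2 * n)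
    {conj : Fin (2 * n) → Fin (2 * n)} (hcs : CentSym A conj) (hgen : NoncentralGenPos n A)
    {M : ℤ} {e : ℕ} (h : CrossingAt n A M e) (T x : ℤ) (p : Fin (2*n)) (hT : T ≤ M - 1)
    (hx : 0 ≤ x) (hxT : x + (M - 1 - T) ≤ e - 1) (hp : psn A (M-1) p = n + x) :
    psn A T p = n + x := by
  have := run_backward hn henc hcs hgen h (M - 1 - T).toNat x p hx (by omega) hp
  rwa [show M - 1 - ((M - 1 - T).toNat : ℤ) = T by omega] at this

/-- If `p` is in the right central position at a time close to a crossing, it takes part in it. -/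
lemma center_forward {n : ℕ} {A : AllowableSeq (2 * n)} (hn : 0 < n) (henc : A.h = 2 * n)
    {conj : Fin (2 * n) → Fin (2 * n)} (hcs : CentSym A conj) (hgen : NoncentralGenPos n A)
    {M : ℤ} {e : ℕ} (h : CrossingAt n A M e) (T : ℤ) (p : Fin (2*n)) (hT : M ≤ T)
    (hxT : T - M ≤ e - 1) (hp : psn A T p = n) : Flips A M p (conj p) := by
  obtain ⟨r, hr⟩ := psn_surj A M (n + 0) (by omega) (by push_cast; omega)
  have h1 := run_forward' hn henc hcs hgen h T 0 r hT le_rfl (by omega) hr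
  have : r = p := psn_inj A T (by omega)
  subst this
  have := h.1
  have b2 := cross_back h r (by omega) (by omega)
  exact inCross_flips hcs ⟨e, h, by omega, by omega⟩

lemma center_backward {n : ℕ} {A : AllowableSeq (2 * n)} (hn : 0 < n) (henc : A.h = 2 * n)
    {conj : Fin (2 * n) → Fin (2 * n)} (hcs : CentSym A conj) (hgen : NoncentralGenPos n A)
    {M : ℤ} {e : ℕ} (h : CrossingAt n A M e) (T : ℤ) (p : Fin (2*n)) (hT : T ≤ M - 1)
    (hxT : M - 1 - T ≤ e - 1) (hp : psn A T p = n) : Flips A M p (conj p) := by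
  obtain ⟨r, hr⟩ := psn_surj A (M-1) (n + 0) (by omega) (by push_cast; omega)
  have h1 := run_backward' hn henc hcs hgen h T 0 r hT le_rfl (by omega) hr
  have : r = p := psn_inj A T (by omega)
  subst this
  have := h.1
  exact inCross_flips hcs ⟨e, h, by omega, by omega⟩

lemma cross_gap {n : ℕ} {A : AllowableSeq (2 * n)} (hn : 0 < n) (henc : A.h = 2 * n)
    {conj : Fin (2 * n) → Fin (2 * n)} (hcs : CentSym A conj) (hgen : NoncentralGenPos n A)
    {M M' : ℤ} {e e' : ℕ} (h : CrossingAt n A M e) (h' : CrossingAt n A M' e') (hM : M < M') :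
    M + e + e' ≤ M' := by
  by_contra hlt
  have := h.1
  have := h'.1
  have := h.2.1
  have := h'.2.1
  obtain ⟨T, hT1, hT2, hT3, hT4⟩ : ∃ T : ℤ, M ≤ T ∧ T - M ≤ e - 1 ∧ T ≤ M' - 1 ∧
      M' - 1 - T ≤ e' - 1 := ⟨max M (M' - e'), by omega, by omega, by omega, by omega⟩
  obtain ⟨p, hp⟩ := psn_surj A T n (by omega) (by push_cast; omega)
  have f1 := center_forward hn henc hcs hgen h T p hT1 hT2 hp
  have f2 := center_backward hn henc hcs hgen h' T p hT3 hT4 hp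
  have := flips_unique hn henc f1 f2 hM
  omega

lemma sig_cover {n t : ℕ} {A : AllowableSeq (2 * n)} (hn : 0 < n) (henc : A.h = 2 * n)
    {conj : Fin (2 * n) → Fin (2 * n)} (hcs : CentSym A conj) (hgen : NoncentralGenPos n A)
    {d : Fin t → ℕ} {m : Fin t → ℤ} (hsig : HasCentralSignature n t A d m) (p : Fin (2*n)) :
    ∃ i, (n : ℤ) - d i ≤ psn A (m i - 1) p ∧ psn A (m i - 1) p < n + d i := by
  have hc0 := psn_conj hcs 0 p
  have hne : p ≠ conj p := by
    intro hh; rw [← hh] at hc0; omega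
  obtain ⟨j, hj1, hj2, hj⟩ := flips_exists henc hne
  have hmi : ∀ e, CrossingAt n A j e → ∃ i, j = m i ∧ e = d i := by
    intro e he
    by_contra hcon
    push Not at hcon
    by_cases hex : ∃ i, j = m i
    · obtain ⟨i, hi⟩ := hex
      have h1 := hsig.2.2.1 i
      rw [← hi] at h1
      exact hcon i hi (le_antisymm (cross_unique_aux h1 he) (cross_unique_aux he h1))
    · push Not at hex
      exact hsig.2.2.2 j (by rw [Finset.mem_Icc]; exact ⟨hj1, hj2⟩) hex e he
  rcases flips_cases hgen hj with ⟨e, he, h1, h2⟩ | ⟨h1, h2, h3⟩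
  · obtain ⟨i, rfl, rfl⟩ := hmi e he
    exact ⟨i, h1, h2⟩
  · have hc := psn_conj hcs (j-1) p
    obtain ⟨e, he⟩ := cross_exists (i := j) hcs hn (by
      intro q hq hq'
      by_cases c1 : psn A (j-1) q = psn A (j-1) p
      · have := psn_inj A _ c1
        subst this
        unfold psn at *; omega
      · have : q = conj p := by
          apply psn_inj A (j-1)
          unfold psn at *; omega
        subst this
        unfold psn at *; omega)
    obtain ⟨i, rfl, rfl⟩ := hmi e he
    have := he.1
    exact ⟨i, by omega, by omega⟩

lemma sig_sum {n t : ℕ} {A : AllowableSeq (2 * n)} (hn : 0 < n) (henc : A.h = 2 * n)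
    {conj : Fin (2 * n) → Fin (2 * n)} (hcs : CentSym A conj) (hgen : NoncentralGenPos n A)
    {d : Fin t → ℕ} {m : Fin t → ℤ} (hsig : HasCentralSignature n t A d m) :
    n ≤ ∑ i, d i := by
  choose f hf1 hf2 using sig_cover hn henc hcs hgen hsig
  have hd : ∀ i, d i ≤ n := fun i => (hsig.2.2.1 i).2.1
  let g : Fin (2*n) → Σ i : Fin t, Fin (2 * d i) := fun p =>
    ⟨f p, ⟨(psn A (m (f p) - 1) p - (n - d (f p))).toNat, by
      have := hf1 p; have := hf2 p; omega⟩⟩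
  have hg : Function.Injective g := by
    intro p q hpq
    have h1 : f p = f q := congrArg Sigma.fst hpq
    have h2 : ((g p).2 : ℕ) = ((g q).2 : ℕ) := by rw [hpq]
    simp only [g] at h2
    have a1 := hf1 p
    have a2 := hf1 q
    rw [h1] at h2 a1
    exact psn_inj A (m (f q) - 1) (by omega)
  have := Fintype.card_le_of_injective g hg
  simp only [Fintype.card_fin, Fintype.card_sigma, ← Finset.mul_sum] at this
  omega

lemma gaps_tight {n t : ℕ} (M : ℕ → ℤ) (D : ℕ → ℤ)
    (hgap : ∀ j < t, M j + D j + D (j+1) ≤ M (j+1)) (h0 : M 0 = 1) (h1 : M t = 2 * n + 1)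
    (hD : D t = D 0) (hs : n ≤ ∑ j ∈ Finset.range t, D j) :
    ∀ j < t, M (j+1) = M j + D j + D (j+1) := by
  have e1 : ∑ j ∈ Finset.range t, (M (j+1) - M j) = M t - M 0 := Finset.sum_range_sub M t
  have e2 : ∑ j ∈ Finset.range t, (D (j+1) - D j) = D t - D 0 := Finset.sum_range_sub D t
  have e3 : ∑ j ∈ Finset.range t, (M (j+1) - M j - D j - D (j+1)) ≤ 0 := by
    simp only [Finset.sum_sub_distrib] at *
    linarith
  have e4 : ∀ j ∈ Finset.range t, 0 ≤ M (j+1) - M j - D j - D (j+1) := by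
    intro j hj
    have := hgap j (Finset.mem_range.1 hj)
    linarith
  have e5 := (Finset.sum_eq_zero_iff_of_nonneg e4).1 (le_antisymm e3 (Finset.sum_nonneg e4))
  intro j hj
  have := e5 j (Finset.mem_range.2 hj)
  linarith

/-- The crossings next to the first one (at `1`) and its shift (at `2n+1`) are as close as
possible. -/
lemma sig_tight {n t : ℕ} {A : AllowableSeq (2 * n)} (hn : 0 < n) (ht : 0 < t)
    (henc : A.h = 2 * n)
    {conj : Fin (2 * n) → Fin (2 * n)} (hcs : CentSym A conj) (hgen : NoncentralGenPos n A)
    {d : Fin t → ℕ} {m : Fin t → ℤ} (hsig : HasCentralSignature n t A d m)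
    (hfirst : m ⟨0, ht⟩ = 1) :
    (∃ (M : ℤ) (e : ℕ), CrossingAt n A M e ∧ M = 1 + d ⟨0, ht⟩ + e) ∧
    (∃ (M : ℤ) (e : ℕ), CrossingAt n A M e ∧ 2 * n + 1 = M + e + d ⟨0, ht⟩) := by
  let M : ℕ → ℤ := fun j => if h : j < t then m ⟨j, h⟩ else 2 * n + 1
  let D : ℕ → ℕ := fun j => if h : j < t then d ⟨j, h⟩ else d ⟨0, ht⟩
  have hM0 : M 0 = 1 := by simp [M, ht, hfirst]
  have hMt : M t = 2 * n + 1 := by simp [M]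
  have hD0 : D 0 = d ⟨0, ht⟩ := by simp [D, ht]
  have hDt : D t = d ⟨0, ht⟩ := by simp [D]
  have hcr : ∀ j, CrossingAt n A (M j) (D j) := by
    intro j
    by_cases hj : j < t
    · simp only [M, D, hj, dif_pos]; exact hsig.2.2.1 _
    · simp only [M, D, hj, dif_neg, not_false_eq_true]
      have h1 := hsig.2.2.1 ⟨0, ht⟩
      rw [hfirst] at h1
      have := cross_shift henc hcs h1
      rwa [add_comm] at this
  have hlt : ∀ j < t, M j < M (j+1) := by
    intro j hj
    by_cases hj' : j + 1 < t
    · simp only [M, hj, hj', dif_pos]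
      exact hsig.1 (by simp [Fin.lt_def])
    · simp only [M, hj, hj', dif_pos, dif_neg, not_false_eq_true]
      have := hsig.2.1 ⟨j, hj⟩
      rw [Finset.mem_Icc] at this
      omega
  have hsum : n ≤ ∑ j ∈ Finset.range t, D j := by
    have := sig_sum hn henc hcs hgen hsig
    rw [Finset.sum_range]
    simpa [D] using this
  have htight := gaps_tight (n := n) (t := t) M (fun j => (D j : ℤ))
    (fun j hj => cross_gap hn henc hcs hgen (hcr j) (hcr (j+1)) (hlt j hj)) hM0 hMt
    (by simp [hD0, hDt]) (by exact_mod_cast hsum)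
  constructor
  · refine ⟨M 1, D 1, hcr 1, ?_⟩
    have := htight 0 ht
    simp only [zero_add] at this
    rw [hM0, hD0] at this
    exact this
  · obtain ⟨s, rfl⟩ : ∃ s, t = s + 1 := ⟨t - 1, by omega⟩
    refine ⟨M s, D s, hcr s, ?_⟩
    have := htight s (by omega)
    rw [hMt, hDt] at this
    exact this

section Paths

variable {n : ℕ} {A : AllowableSeq (2 * n)} {conj : Fin (2 * n) → Fin (2 * n)} {D : ℕ}

lemma s_noflip (hn : 0 < n) (henc : A.h = 2 * n) (hc : CrossingAt n A 1 D) {k l : ℤ}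
    {p q : Fin (2*n)} (hk1 : 1 ≤ k) (hkD : k ≤ D) (hp : psn A (1-1) p = n - D + k - 1)
    (hl1 : 1 ≤ l) (hlD : l ≤ D) (hq : psn A (1-1) q = n - D + l - 1)
    {i : ℤ} (hi : 2 ≤ i) (hi' : i ≤ 2 * n) : ¬ Flips A i p q := by
  intro hf
  have h1 : Flips A 1 p q :=
    cross_flips hc (by omega) (by omega) (by omega) (by omega) (flips_ne hf)
  have := flips_unique hn henc h1 hf (by omega)
  omega

lemma s_nocross (hn : 0 < n) (henc : A.h = 2 * n) (hcs : CentSym A conj)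
    (hc : CrossingAt n A 1 D) {k : ℤ}
    {p : Fin (2*n)} (hk1 : 1 ≤ k) (hkD : k ≤ D) (hp : psn A (1-1) p = n - D + k - 1)
    {i : ℤ} (hi : 2 ≤ i) (hi' : i ≤ 2 * n) : ¬ InCross n A i p := by
  intro hf
  have h1 : Flips A 1 p (conj p) := inCross_flips hcs ⟨D, hc, by omega, by omega⟩
  have := flips_unique hn henc h1 (inCross_flips hcs hf) (by omega)
  omega

lemma s_move (hn : 0 < n) (henc : A.h = 2 * n) (hcs : CentSym A conj)
    (hgen : NoncentralGenPos n A)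
    (hc : CrossingAt n A 1 D) {k : ℤ}
    {p : Fin (2*n)} (hk1 : 1 ≤ k) (hkD : k ≤ D) (hp : psn A (1-1) p = n - D + k - 1)
    {i : ℤ} (hi : 2 ≤ i) (hi' : i ≤ 2 * n) (hm : psn A i p ≠ psn A (i-1) p) :
    ∃ q, Flips A i p q ∧ psn A i p = psn A (i-1) q ∧
      psn A i q = psn A (i-1) p ∧
      (psn A i p = psn A (i-1) p + 1 ∨ psn A i p = psn A (i-1) p - 1) :=
  (move_cases hgen hm).resolve_left (s_nocross hn henc hcs hc hk1 hkD hp hi hi')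

lemma s_unit (hn : 0 < n) (henc : A.h = 2 * n) (hcs : CentSym A conj)
    (hgen : NoncentralGenPos n A)
    (hc : CrossingAt n A 1 D) {k : ℤ}
    {p : Fin (2*n)} (hk1 : 1 ≤ k) (hkD : k ≤ D) (hp : psn A (1-1) p = n - D + k - 1)
    {i : ℤ} (hi : 2 ≤ i) (hi' : i ≤ 2 * n) :
    psn A i p = psn A (i-1) p ∨ psn A i p = psn A (i-1) p + 1 ∨
      psn A i p = psn A (i-1) p - 1 := by
  by_cases hm : psn A i p = psn A (i-1) p
  · exact Or.inl hm
  · obtain ⟨q, -, -, -, h⟩ := s_move hn henc hcs hgen hc hk1 hkD hp hi hi' hm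
    exact Or.inr h

lemma start_position (hn : 0 < n) (henc : A.h = 2 * n) (hcs : CentSym A conj)
    (hgen : NoncentralGenPos n A)
    (hc : CrossingAt n A 1 D) {k : ℤ}
    {p : Fin (2*n)} (hk1 : 1 ≤ k) (hkD : k ≤ D) (hp : psn A (1-1) p = n - D + k - 1)
    {i : ℤ} (hi : 1 ≤ i) (hi' : i ≤ k) : psn A i p = n + D - k := by
  have h1 := cross_psn hc p (by omega) (by omega)
  have := run_forward' hn henc hcs hgen hc i (D - k) p hi (by omega) (by omega) (by omega)
  omega

lemma end_position (hn : 0 < n) (henc : A.h = 2 * n) (hcs : CentSym A conj)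
    (hgen : NoncentralGenPos n A)
    (hc : CrossingAt n A 1 D) {k : ℤ}
    {p : Fin (2*n)} (hk1 : 1 ≤ k) (hkD : k ≤ D) (hp : psn A (1-1) p = n - D + k - 1)
    {i : ℤ} (hi : 2 * n - k + 1 ≤ i) (hi' : i ≤ 2 * n) : psn A i p = n + D - k := by
  have h1 := psn_rev henc (1-1) p
  have hs : (1 : ℤ) - 1 + 2 * n = 1 + 2 * n - 1 := by ring
  rw [hs] at h1
  have := run_backward' hn henc hcs hgen (cross_shift henc hcs hc) i (D - k) p (by omega)
    (by omega) (by omega) (by omega)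
  omega

/-- `s(l)` stays left of `s(k)` for `k < l` during the halfperiod. -/
lemma s_order (hn : 0 < n) (henc : A.h = 2 * n) (hcs : CentSym A conj)
    (hgen : NoncentralGenPos n A) (hc : CrossingAt n A 1 D) {k l : ℤ}
    {p q : Fin (2*n)} (hk1 : 1 ≤ k) (hkD : k ≤ D) (hp : psn A (1-1) p = n - D + k - 1)
    (hl1 : 1 ≤ l) (hlD : l ≤ D) (hq : psn A (1-1) q = n - D + l - 1) (hkl : k < l)
    {i : ℤ} (hi : 1 ≤ i) (hi' : i ≤ 2 * n) : psn A i q < psn A i p := by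
  induction i, hi using Int.le_induction with
  | base =>
    have h1 := start_position hn henc hcs hgen hc hk1 hkD hp le_rfl hk1
    have h2 := start_position hn henc hcs hgen hc hl1 hlD hq le_rfl hl1
    omega
  | succ i hi ih =>
    have ih := ih (by omega)
    have := s_noflip hn henc hc hl1 hlD hq hk1 hkD hp (i := i + 1) (by omega) (by omega)
    rw [flips_iff, add_sub_cancel_right] at this
    tauto

lemma s_upper (hn : 0 < n) (henc : A.h = 2 * n) (hcs : CentSym A conj)
    (hgen : NoncentralGenPos n A) (hc : CrossingAt n A 1 D) {k : ℤ} (hk1 : 1 ≤ k) :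
    ∀ {p : Fin (2*n)}, k ≤ D → psn A (1-1) p = n - D + k - 1 →
    ∀ {i : ℤ}, 1 ≤ i → i ≤ 2 * n → psn A i p ≤ 2 * n - k := by
  have := hc.2.1
  induction k, hk1 using Int.le_induction with
  | base =>
    intro p _ _ i _ _
    have := psn_lt A i p
    push_cast at this
    omega
  | succ k hk ih =>
    intro p hkD hp i hi hi'
    obtain ⟨q, hq⟩ := psn_surj A (1-1) (n - D + k - 1) (by omega) (by push_cast; omega)
    have h1 := ih (by omega) hq hi hi'
    have h2 := s_order hn henc hcs hgen hc hk (by omega) hq (by omega) hkD hp (by omega) hi hi'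
    omega

/-- Description of the trajectory of `s(k)`. -/
def GoodPath (n : ℕ) (A : AllowableSeq (2 * n)) (D : ℕ) (k : ℤ) (p : Fin (2 * n)) : Prop :=
  (∀ i : ℤ, k ≤ i → i ≤ k + n - D → psn A i p = n + D - k + (i - k)) ∧
  (∀ i : ℤ, k + n - D ≤ i → i ≤ n + D - k + 1 → psn A i p = 2 * n - k) ∧
  (∀ i : ℤ, n + D - k + 1 ≤ i → i ≤ 2 * n - k + 1 → psn A i p = n + D - k + (2 * n - k + 1 - i))

lemma good_step (hn : 0 < n) (henc : A.h = 2 * n) (hcs : CentSym A conj)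
    (hgen : NoncentralGenPos n A) (hc : CrossingAt n A 1 D) {k : ℤ}
    {p q : Fin (2*n)} (hk1 : 1 ≤ k) (hkD : k + 1 ≤ D) (hp : psn A (1-1) p = n - D + k - 1)
    (hq : psn A (1-1) q = n - D + (k + 1) - 1) (hg : GoodPath n A D (k+1) q) :
    GoodPath n A D k p := by
  have hDn := hc.2.1
  obtain ⟨g1, g2, g3⟩ := hg
  have ord : ∀ i : ℤ, 1 ≤ i → i ≤ 2 * n → psn A i q < psn A i p := fun i h1 h2 =>
    s_order hn henc hcs hgen hc hk1 (by omega) hp (by omega) hkD hq (by omega) h1 h2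
  have nf : ∀ i : ℤ, 2 ≤ i → i ≤ 2 * n → ¬ Flips A i q p := fun i h1 h2 =>
    s_noflip hn henc hc (by omega) hkD hq hk1 (by omega) hp h1 h2
  have mv : ∀ i : ℤ, 2 ≤ i → i ≤ 2 * n → psn A i q ≠ psn A (i-1) q →
      psn A i q ≠ psn A (i-1) p ∧ psn A (i-1) q ≠ psn A i p := by
    intro i h1 h2 h3
    obtain ⟨r, hr, h4, h5, h6⟩ := s_move hn henc hcs hgen hc (by omega) hkD hq h1 h2 h3
    constructor
    · intro h7
      have : r = p := psn_inj A (i-1) (by omega)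
      subst this
      exact nf i h1 h2 hr
    · intro h7
      have : r = p := psn_inj A i (by omega)
      subst this
      exact nf i h1 h2 hr
  have un : ∀ i : ℤ, 2 ≤ i → i ≤ 2 * n → _ := fun i h1 h2 =>
    s_unit hn henc hcs hgen hc hk1 (by omega) hp (i := i) h1 h2
  have hk0 := start_position hn henc hcs hgen hc hk1 (by omega) hp hk1 le_rfl
  have hk2 := end_position hn henc hcs hgen hc hk1 (by omega) hp (i := 2 * n - k + 1) le_rfl (by omega)
  have up1 : ∀ i : ℤ, k ≤ i → i ≤ 2 * n → psn A i p ≤ n + D - k + (i - k) := by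
    intro i hi
    induction i, hi using Int.le_induction with
    | base => intro _; omega
    | succ i hi ih =>
      intro h
      have a := ih (by omega)
      have b := un (i+1) (by omega) h
      rw [add_sub_cancel_right] at b
      omega
  have up2 : ∀ i : ℤ, i ≤ 2 * n - k + 1 → 1 ≤ i →
      psn A i p ≤ n + D - k + (2 * n - k + 1 - i) := by
    intro i hi
    induction i, hi using Int.le_induction_down with
    | base => intro _; omega
    | pred i hi ih =>
      intro h
      have a := ih (by omega)
      have b := un i (by omega) (by omega)
      omega
  have r1 : ∀ i : ℤ, k ≤ i → i ≤ k + n - D → psn A i p = n + D - k + (i - k) := by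
    intro i h1 h2
    rcases eq_or_lt_of_le h1 with h | h
    · subst h; omega
    have a1 := g1 i (by omega) (by omega)
    have a2 := g1 (i+1) (by omega) (by omega)
    have a3 := mv (i+1) (by omega) (by omega) (by rw [add_sub_cancel_right]; omega)
    rw [add_sub_cancel_right] at a3
    have a4 := ord i (by omega) (by omega)
    have a5 := up1 i h1 (by omega)
    omega
  have r3 : ∀ i : ℤ, n + D - k + 1 ≤ i → i ≤ 2 * n - k + 1 →
      psn A i p = n + D - k + (2 * n - k + 1 - i) := by
    intro i h1 h2
    rcases eq_or_lt_of_le h2 with h | h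
    · subst h; omega
    have a1 := g3 i (by omega) (by omega)
    have a2 := g3 (i-1) (by omega) (by omega)
    have a3 := mv i (by omega) (by omega) (by omega)
    have a4 := ord i (by omega) (by omega)
    have a5 := up2 i h2 (by omega)
    omega
  refine ⟨r1, ?_, r3⟩
  intro i h1 h2
  rcases eq_or_lt_of_le h1 with h | h
  · have := r1 i (by omega) (by omega)
    omega
  rcases eq_or_lt_of_le h2 with h' | h'
  · have := r3 i (by omega) (by omega)
    omega
  have a1 := g2 i (by omega) (by omega)
  have a4 := ord i (by omega) (by omega)
  have a5 := s_upper hn henc hcs hgen hc hk1 (by omega) hp (i := i) (by omega) (by omega)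
  omega

lemma zero_unique (hn : 0 < n) (henc : A.h = 2 * n) (hcs : CentSym A conj)
    (hgen : NoncentralGenPos n A) (hc : CrossingAt n A 1 D)
    {p : Fin (2*n)} (hp : psn A (1-1) p = n - D + (D:ℤ) - 1)
    {z w : ℤ} (hz1 : D + 1 ≤ z) (hz2 : z ≤ 2 * n - D + 1) (hw1 : D + 1 ≤ w)
    (hw2 : w ≤ 2 * n - D + 1)
    (hz : psn A z p = psn A (z-1) p) (hw : psn A w p = psn A (w-1) p) : z = w := by
  classical
  by_contra hzw
  have hDn := hc.2.1
  have hD1 := hc.1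
  let O : Finset (Fin (2*n)) := Finset.univ.filter
    (fun q => psn A (1-1) q < n - D ∨ (n:ℤ) + D ≤ psn A (1-1) q)
  have hneO : ∀ q ∈ O, p ≠ q := by
    rintro q hq rfl
    simp only [O, Finset.mem_filter, Finset.mem_univ, true_and] at hq
    omega
  have hnc : ∀ i : ℤ, 2 ≤ i → i ≤ 2 * n → ¬ InCross n A i p := fun i h1 h2 =>
    s_nocross hn henc hcs hc (by omega) le_rfl hp h1 h2
  have hfl : ∀ i : ℤ, 2 ≤ i → i ≤ 2 * n → ∀ q, Flips A i p q → _ := fun i h1 h2 q h =>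
    (flips_cases hgen h).resolve_left (hnc i h1 h2)
  have hex : ∀ q, ∃ i : ℤ, q ∈ O → (i ∈ ((Finset.Icc (D + 1 : ℤ) (2 * n - D + 1)).erase z).erase w
      ∧ Flips A i p q) := by
    intro q
    by_cases hq : q ∈ O
    swap
    · exact ⟨0, fun h => absurd h hq⟩
    have hne := hneO q hq
    obtain ⟨i, h1, h2, h3⟩ := flips_exists henc hne
    refine ⟨i, fun _ => ⟨?_, h3⟩⟩
    simp only [O, Finset.mem_filter, Finset.mem_univ, true_and] at hq
    have hi1 : i ≠ 1 := by
      rintro rfl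
      have e1 := cross_psn hc p (by omega) (by omega)
      rw [flips_iff] at h3
      have e2 : ¬ ((n:ℤ) - D ≤ psn A 1 q ∧ psn A 1 q < n + D) := by
        rintro ⟨u, v⟩
        have := cross_back hc q u v
        omega
      -- the order of an outside point against `p` is kept by the interval lemma
      rcases flips_cases hgen (flips_symm (by rw [flips_iff]; exact h3)) with ⟨e, he, u, v⟩ | u
      · have := cross_unique_aux hc he
        omega
      · omega
    have hf := hfl i (by omega) h2 q h3
    have hd1 : ¬ i ≤ D := by
      intro hh
      have u := start_position hn henc hcs hgen hc (by omega) le_rfl hp (i := i) (by omega) hh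
      have v := start_position hn henc hcs hgen hc (by omega) le_rfl hp (i := i-1) (by omega) (by omega)
      omega
    have hd2 : ¬ 2 * n - D + 2 ≤ i := by
      intro hh
      have u := end_position hn henc hcs hgen hc (by omega) le_rfl hp (i := i) (by omega) h2
      have v := end_position hn henc hcs hgen hc (by omega) le_rfl hp (i := i-1) (by omega) (by omega)
      omega
    rw [Finset.mem_erase, Finset.mem_erase, Finset.mem_Icc]
    refine ⟨?_, ?_, by omega, by omega⟩
    · rintro rfl; omega
    · rintro rfl; omega
  choose f hf using hex
  have hcard : O.card ≤ (((Finset.Icc (D + 1 : ℤ) (2 * n - D + 1)).erase z).erase w).card := by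
    apply Finset.card_le_card_of_injOn f (fun q hq => (hf q hq).1)
    intro q hq q' hq' hqq
    obtain ⟨u1, u2⟩ := hf q hq
    obtain ⟨v1, v2⟩ := hf q' hq'
    rw [← hqq] at v2
    rw [Finset.mem_erase, Finset.mem_erase, Finset.mem_Icc] at u1
    have a := hfl _ (by omega) (by omega) q u2
    have b := hfl _ (by omega) (by omega) q' v2
    exact psn_inj A (f q - 1) (by omega)
  rw [Finset.card_erase_of_mem, Finset.card_erase_of_mem, Int.card_Icc] at hcard
  rotate_left
  · rw [Finset.mem_Icc]; omega
  · rw [Finset.mem_erase, Finset.mem_Icc]; exact ⟨fun h => hzw h.symm, by omega, by omega⟩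
  have hO : 2 * n ≤ O.card + 2 * D := by
    have h1 : (Finset.univ.filter (fun q : Fin (2*n) => ¬ (psn A (1-1) q < n - D ∨
        (n:ℤ) + D ≤ psn A (1-1) q))).card ≤ (Finset.Ico ((n:ℤ) - D) (n + D)).card := by
      apply Finset.card_le_card_of_injOn (fun q => psn A (1-1) q)
      · intro q hq
        simp only [Finset.coe_filter, Finset.mem_univ, true_and, Set.mem_setOf_eq] at hq
        simp only [Finset.coe_Ico, Set.mem_Ico]
        omega
      · intro q _ q' _ h
        exact psn_inj A (1-1) h
    have h2 := Finset.card_filter_add_card_filter_not (s := (Finset.univ : Finset (Fin (2*n))))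
      (fun q : Fin (2*n) => (psn A (1-1) q < n - D ∨ (n:ℤ) + D ≤ psn A (1-1) q))
    rw [Int.card_Ico] at h1
    rw [Finset.card_univ, Fintype.card_fin] at h2
    change O.card + _ = _ at h2
    omega
  omega

lemma good_base (hn : 0 < n) (henc : A.h = 2 * n) (hcs : CentSym A conj)
    (hgen : NoncentralGenPos n A) (hc : CrossingAt n A 1 D)
    (ht1 : ∃ (M : ℤ) (e : ℕ), CrossingAt n A M e ∧ M = 1 + D + e)
    (ht2 : ∃ (M : ℤ) (e : ℕ), CrossingAt n A M e ∧ 2 * n + 1 = M + e + D)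
    {p : Fin (2*n)} (hp : psn A (1-1) p = n - D + (D:ℤ) - 1) : GoodPath n A D D p := by
  have hDn := hc.2.1
  have hD1 := hc.1
  have i0 := start_position hn henc hcs hgen hc (by omega) le_rfl hp (i := D) (by omega) le_rfl
  have i1 := end_position hn henc hcs hgen hc (by omega) le_rfl hp (i := 2 * n - D + 1) le_rfl (by omega)
  by_cases hDn' : D = n
  · subst hDn'
    refine ⟨?_, ?_, ?_⟩
    · intro i h1 h2
      have : i = D := by omega
      subst this; omega
    · intro i h1 h2
      have : i = D ∨ i = 2 * D - D + 1 := by omega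
      rcases this with rfl | rfl <;> omega
    · intro i h1 h2
      have : i = 2 * D - D + 1 := by omega
      subst this; omega
  have fc : Flips A 1 p (conj p) := inCross_flips hcs ⟨D, hc, by omega, by omega⟩
  have fc' : Flips A (1 + 2 * n) p (conj p) := (flips_shift henc 1 p (conj p)).2 fc
  have un : ∀ i : ℤ, 2 ≤ i → i ≤ 2 * n → _ := fun i h1 h2 =>
    s_unit hn henc hcs hgen hc (by omega) le_rfl hp (i := i) h1 h2
  have hnm1 : ∀ i : ℤ, 2 ≤ i → i ≤ 2 * n → ¬ (psn A (i-1) p = n ∧ psn A i p = n - 1) := by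
    rintro i h1 h2 ⟨h3, h4⟩
    have c1 := psn_conj hcs i p
    have c2 := psn_conj hcs (i-1) p
    have : Flips A i p (conj p) := by rw [flips_iff]; omega
    have := flips_unique hn henc fc this (by omega)
    omega
  have hnm2 : ∀ i : ℤ, 2 ≤ i → i ≤ 2 * n → ¬ (psn A (i-1) p = n - 1 ∧ psn A i p = n) := by
    rintro i h1 h2 ⟨h3, h4⟩
    have c1 := psn_conj hcs i p
    have c2 := psn_conj hcs (i-1) p
    have : Flips A i p (conj p) := by rw [flips_iff]; omega
    have := flips_unique hn henc fc this (by omega)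
    omega
  have first : psn A (D+1) p = n + 1 := by
    have h1 := un (D+1) (by omega) (by omega)
    have h2 := hnm1 (D+1) (by omega) (by omega)
    rw [add_sub_cancel_right] at h1 h2
    have h3 : psn A (D+1) p ≠ n := by
      intro h
      obtain ⟨M, e, he, hM⟩ := ht1
      have := he.1
      have := he.2.1
      have f := center_backward hn henc hcs hgen he (D+1) p (by omega) (by omega) h
      have := flips_unique hn henc fc f (by omega)
      omega
    omega
  have last : psn A (2 * n - D) p = n + 1 := by
    have h1 := un (2 * n - D + 1) (by omega) (by omega)
    have h2 := hnm2 (2 * n - D + 1) (by omega) (by omega)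
    rw [add_sub_cancel_right] at h1 h2
    have h3 : psn A (2 * n - D) p ≠ n := by
      intro h
      obtain ⟨M, e, he, hM⟩ := ht2
      have := he.1
      have := he.2.1
      have f := center_forward hn henc hcs hgen he (2 * n - D) p (by omega) (by omega) h
      have := flips_unique hn henc f fc' (by omega)
      omega
    omega
  -- consecutive jumps have the same direction
  have turn : ∀ i : ℤ, 2 ≤ i → i + 1 ≤ 2 * n → psn A i p ≠ psn A (i-1) p →
      psn A (i+1) p ≠ psn A i p → psn A (i+1) p ≠ psn A (i-1) p := by
    intro i h1 h2 h3 h4 h5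
    obtain ⟨q, hq, a1, a2, a3⟩ := s_move hn henc hcs hgen hc (by omega) le_rfl hp h1 (by omega) h3
    obtain ⟨r, hr, b1, b2, b3⟩ := s_move hn henc hcs hgen hc (by omega) le_rfl hp
      (i := i+1) (by omega) h2 (by rw [add_sub_cancel_right]; exact h4)
    rw [add_sub_cancel_right] at b1 b2 b3
    have : r = q := psn_inj A i (by omega)
    subst this
    have := flips_unique hn henc hq hr (by omega)
    omega
  have upto : ∀ z : ℤ, z ≤ 2 * n - D + 2 →
      (∀ w : ℤ, D + 1 ≤ w → w < z → psn A w p ≠ psn A (w-1) p) →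
      ∀ i : ℤ, D + 1 ≤ i → i < z → psn A i p = psn A (i-1) p + 1 := by
    intro z hz hw i hi
    induction i, hi using Int.le_induction with
    | base => intro _; rw [add_sub_cancel_right]; omega
    | succ i hi ih =>
      intro hlt
      have a := ih (by omega)
      have b := hw (i+1) (by omega) hlt
      have c := un (i+1) (by omega) (by omega)
      rw [add_sub_cancel_right] at *
      have e := turn i (by omega) (by omega) (by omega) b
      omega
  have downto : ∀ z : ℤ, D ≤ z →
      (∀ w : ℤ, z < w → w ≤ 2 * n - D + 1 → psn A w p ≠ psn A (w-1) p) →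
      ∀ i : ℤ, i ≤ 2 * n - D + 1 → z < i → psn A i p = psn A (i-1) p - 1 := by
    intro z hz hw i hi
    induction i, hi using Int.le_induction_down with
    | base => intro _; rw [add_sub_cancel_right]; omega
    | pred i hi ih =>
      intro hlt
      have a := ih (by omega)
      have b := hw (i-1) hlt (by omega)
      have c := un (i-1) (by omega) (by omega)
      have e := turn (i-1) (by omega) (by omega) b
      rw [sub_add_cancel] at e
      have := e (by omega)
      omega
  obtain ⟨z, hz1, hz2, hz⟩ : ∃ z : ℤ, D + 1 ≤ z ∧ z ≤ 2 * n - D + 1 ∧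
      psn A z p = psn A (z-1) p := by
    by_contra hcon
    push Not at hcon
    have := upto (2 * n - D + 2) le_rfl (fun w h1 h2 => hcon w h1 (by omega)) (2 * n - D + 1)
      (by omega) (by omega)
    rw [add_sub_cancel_right] at this
    omega
  have U := upto z (by omega) (fun w h1 h2 h3 => by
    have := zero_unique hn henc hcs hgen hc hp hz1 hz2 h1 (by omega) hz h3
    omega)
  have L := downto z (by omega) (fun w h1 h2 h3 => by
    have := zero_unique hn henc hcs hgen hc hp hz1 hz2 (by omega) h2 hz h3
    omega)
  have U' : ∀ i : ℤ, D ≤ i → i < z → psn A i p = n + (i - D) := by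
    intro i hi
    induction i, hi using Int.le_induction with
    | base => intro _; omega
    | succ i hi ih =>
      intro h
      have a := ih (by omega)
      have b := U (i+1) (by omega) h
      rw [add_sub_cancel_right] at b
      omega
  have L' : ∀ i : ℤ, i ≤ 2 * n - D + 1 → z ≤ i → psn A i p = n + (2 * n - D + 1 - i) := by
    intro i hi
    induction i, hi using Int.le_induction_down with
    | base => intro _; omega
    | pred i hi ih =>
      intro h
      have a := ih (by omega)
      have b := L i hi (by omega)
      omega
  have u := U' (z-1) (by omega) (by omega)
  have l := L' z hz2 le_rfl
  have hzn : z = n + 1 := by omega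
  subst hzn
  refine ⟨?_, ?_, ?_⟩
  · intro i h1 h2
    have := U' i (by omega) (by omega)
    omega
  · intro i h1 h2
    have : i = n ∨ i = n + 1 := by omega
    rcases this with rfl | rfl
    · have := U' n (by omega) (by omega)
      omega
    · omega
  · intro i h1 h2
    have := L' i (by omega) (by omega)
    omega

lemma good_all (hn : 0 < n) (henc : A.h = 2 * n) (hcs : CentSym A conj)
    (hgen : NoncentralGenPos n A) (hc : CrossingAt n A 1 D)
    (ht1 : ∃ (M : ℤ) (e : ℕ), CrossingAt n A M e ∧ M = 1 + D + e)
    (ht2 : ∃ (M : ℤ) (e : ℕ), CrossingAt n A M e ∧ 2 * n + 1 = M + e + D)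
    {k : ℤ} (hkD : k ≤ D) : ∀ {p : Fin (2*n)}, 1 ≤ k → psn A (1-1) p = n - D + k - 1 →
    GoodPath n A D k p := by
  have hDn := hc.2.1
  induction k, hkD using Int.le_induction_down with
  | base => intro p _ hp; exact good_base hn henc hcs hgen hc ht1 ht2 hp
  | pred k hk ih =>
    intro p hk1 hp
    obtain ⟨q, hq⟩ := psn_surj A (1-1) (n - D + k - 1) (by omega) (by push_cast; omega)
    have := ih (by omega) hq
    refine good_step hn henc hcs hgen hc hk1 (by omega) hp (q := q) ?_ ?_
    · rw [sub_add_cancel]; exact hq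
    · rw [sub_add_cancel]; exact this

end Paths

/-- Path of the point `s₁(k)` of the first crossing substring in an even-near-critical
centrally symmetric allowable sequence of `2n` points in noncentral general position
with first crossing switch in the first move: a central jump (move 1), then `k - 1`
passive jumps, then `n - d₁` right jumps, then `2(d₁ - k) + 1` passive jumps, then
`n - d₁` left jumps, then `k - 1` passive jumps. -/
theorem stmt_9 (n t : ℕ) (hn : 0 < n) (ht : 0 < t) (A : AllowableSeq (2 * n))
    (conj : Fin (2 * n) → Fin (2 * n)) (hcs : CentSym A conj)
    (henc : A.h = 2 * n) (hgen : NoncentralGenPos n A)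
    (d : Fin t → ℕ) (m : Fin t → ℤ) (hsig : HasCentralSignature n t A d m)
    (hfirst : m ⟨0, ht⟩ = 1)
    (k : ℕ) (hk1 : 1 ≤ k) (hk2 : k ≤ d ⟨0, ht⟩)
    (p : Fin (2 * n)) (hp : ((A.perm 0) p : ℕ) = n - d ⟨0, ht⟩ + (k - 1)) :
    (((A.perm 1) p : ℕ) = 2 * n - 1 - ((A.perm 0) p : ℕ)) ∧
    (∀ i : ℤ, 2 ≤ i → i ≤ (k : ℤ) →
      (A.perm i) p = (A.perm (i - 1)) p) ∧
    (∀ i : ℤ, (k : ℤ) + 1 ≤ i → i ≤ (k : ℤ) + ((n - d ⟨0, ht⟩ : ℕ) : ℤ) →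
      (A.perm (i - 1)) p < (A.perm i) p) ∧
    (∀ i : ℤ, (k : ℤ) + ((n - d ⟨0, ht⟩ : ℕ) : ℤ) + 1 ≤ i →
        i ≤ (k : ℤ) + ((n - d ⟨0, ht⟩ : ℕ) : ℤ) + 2 * ((d ⟨0, ht⟩ : ℤ) - k) + 1 →
      (A.perm i) p = (A.perm (i - 1)) p) ∧
    (∀ i : ℤ, (k : ℤ) + ((n - d ⟨0, ht⟩ : ℕ) : ℤ) + 2 * ((d ⟨0, ht⟩ : ℤ) - k) + 2 ≤ i →
        i ≤ (k : ℤ) + 2 * ((n - d ⟨0, ht⟩ : ℕ) : ℤ) + 2 * ((d ⟨0, ht⟩ : ℤ) - k) + 1 →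
      (A.perm i) p < (A.perm (i - 1)) p) ∧
    (∀ i : ℤ, 2 * (n : ℤ) - k + 2 ≤ i → i ≤ 2 * (n : ℤ) →
      (A.perm i) p = (A.perm (i - 1)) p) := by
  have hc : CrossingAt n A 1 (d ⟨0, ht⟩) := hfirst ▸ hsig.2.2.1 ⟨0, ht⟩
  obtain ⟨ht1, ht2⟩ := sig_tight hn ht henc hcs hgen hsig hfirst
  generalize d ⟨0, ht⟩ = D at *
  have hDn := hc.2.1
  have hD1 := hc.1
  have hp' : psn A (1-1) p = n - D + (k:ℤ) - 1 := by
    rw [sub_self]; unfold psn; omega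
  have hk1' : (1:ℤ) ≤ k := by omega
  have hk2' : (k:ℤ) ≤ D := by omega
  obtain ⟨g1, g2, g3⟩ := good_all hn henc hcs hgen hc ht1 ht2 hk2' hk1' hp'
  have i0 : ∀ i : ℤ, 1 ≤ i → i ≤ k → _ := fun i h1 h2 =>
    start_position hn henc hcs hgen hc hk1' hk2' hp' (i := i) h1 h2
  have i1 : ∀ i : ℤ, 2 * n - k + 1 ≤ i → i ≤ 2 * n → _ := fun i h1 h2 =>
    end_position hn henc hcs hgen hc hk1' hk2' hp' (i := i) h1 h2
  have eqs : ∀ i : ℤ, psn A i p = psn A (i-1) p → (A.perm i) p = (A.perm (i - 1)) p := by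
    intro i h
    unfold psn at h
    exact Fin.ext (by omega)
  have lts : ∀ i j : ℤ, psn A i p < psn A j p → (A.perm i) p < (A.perm j) p := by
    intro i j h
    unfold psn at h
    exact Fin.lt_def.2 (by omega)
  rw [Nat.cast_sub hDn]
  refine ⟨?_, ?_, ?_, ?_, ?_, ?_⟩
  · have h1 := cross_psn hc p (by omega) (by omega)
    rw [sub_self] at h1
    unfold psn at h1
    omega
  · intro i h1 h2
    have a := i0 i (by omega) (by omega)
    have b := i0 (i-1) (by omega) (by omega)
    exact eqs i (by omega)
  · intro i h1 h2
    have a := g1 i (by omega) (by omega)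
    have b := g1 (i-1) (by omega) (by omega)
    exact lts _ _ (by omega)
  · intro i h1 h2
    have a := g2 i (by omega) (by omega)
    have b := g2 (i-1) (by omega) (by omega)
    exact eqs i (by omega)
  · intro i h1 h2
    have a := g3 i (by omega) (by omega)
    have b := g3 (i-1) (by omega) (by omega)
    exact lts _ _ (by omega)
  · intro i h1 h2
    have a := i1 i (by omega) (by omega)
    have b := i1 (i-1) (by omega) (by omega)
    exact eqs i (by omega)
end

section
/- Every sequence (d₁, ..., dₜ) of positive integers with t ≥ 2 is the central signature of some even-near-critical centrally symmetric allowable sequence in noncentral general position. -/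
/-- distance from the centre -/
def cpos (n D d k T : ℤ) : ℤ :=
  if T < 2*D+d then max k (min (n-d+k) (min (T+2*n+1+2*k-2*D-2*d) (2*D+2*k-T)))
  else max k (min (n-d+k) (min (T+1+2*k-2*D-2*d) (2*n+2*D+2*k-T)))

/-- signed position of a point -/
def fpos (n D d k T : ℤ) (b : Bool) : ℤ :=
  if (T < 2*D+d ↔ b = true) then n + cpos n D d k T else n - 1 - cpos n D d k T

theorem cpos_bound (n D d k T : ℤ) (hk : 0 ≤ k) (hkd : k < d) (hD : 0 ≤ D) (hn : D + d ≤ n) :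
    0 ≤ cpos n D d k T ∧ cpos n D d k T < n := by
  unfold cpos; split_ifs <;> omega

theorem cpos_same (n D d k l T : ℤ) (hk : 0 ≤ k) (hkl : k < l) (hkd : l < d) (hD : 0 ≤ D) (hn : D + d ≤ n)
   : cpos n D d k T < cpos n D d l T := by
  unfold cpos; split_ifs <;> omega

theorem cpos_mid (n D d k D' d' l T : ℤ) (hk : 0 ≤ k) (hkd : k < d) (hD : 0 ≤ D)
    (hl : 0 ≤ l) (hld : l < d') (h : D + d ≤ D') (hn : D' + d' ≤ n)
    (h1 : 2*D+d ≤ T) (h2 : T < 2*D'+d') :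
    (T < D + d + D' + l - k → cpos n D d k T < cpos n D' d' l T) ∧
    (D + d + D' + l - k ≤ T → cpos n D' d' l T < cpos n D d k T) := by
  unfold cpos; rw [if_neg (by omega), if_pos (by omega)]; constructor <;> intro h3 <;> omega

theorem cpos_lo (n D d k D' d' l T : ℤ) (hk : 0 ≤ k) (hkd : k < d) (hD : 0 ≤ D)
    (hl : 0 ≤ l) (hld : l < d') (h : D + d ≤ D') (hn : D' + d' ≤ n)
    (h1 : 0 ≤ T) (h2 : T < 2*D+d) :
    (T < D' + d' + D + k - l - n → cpos n D' d' l T < cpos n D d k T) ∧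
    (D' + d' + D + k - l - n ≤ T → cpos n D d k T < cpos n D' d' l T) := by
  unfold cpos; rw [if_pos (by omega), if_pos (by omega)]; constructor <;> intro h3 <;> omega

theorem cpos_hi (n D d k D' d' l T : ℤ) (hk : 0 ≤ k) (hkd : k < d) (hD : 0 ≤ D)
    (hl : 0 ≤ l) (hld : l < d') (h : D + d ≤ D') (hn : D' + d' ≤ n)
    (h1 : 2*D'+d' ≤ T) (h2 : T ≤ 2*n) :
    (T < D' + d' + D + k - l + n → cpos n D' d' l T < cpos n D d k T) ∧
    (D' + d' + D + k - l + n ≤ T → cpos n D d k T < cpos n D' d' l T) := by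
  unfold cpos; rw [if_neg (by omega), if_neg (by omega)]; constructor <;> intro h3 <;> omega

/-- single step, away from the own crossing -/
theorem cpos_step (n D d k T : ℤ) (hk : 0 ≤ k) (hkd : k < d) (hD : 0 ≤ D) (hn : D + d ≤ n)
    (h1 : 1 ≤ T) (h2 : T ≤ 2*n) (hT : T ≠ 2*D+d) :
    cpos n D d k T = cpos n D d k (T-1) ∨
    (cpos n D d k T = cpos n D d k (T-1) + 1 ∧ (cpos n D d k (T-1) + T) % 2 = 0) ∨
    (cpos n D d k T = cpos n D d k (T-1) - 1 ∧ (cpos n D d k (T-1) + T) % 2 = 1) := by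
  unfold cpos
  by_cases h : T < 2*D+d
  · rw [if_pos (by omega), if_pos (by omega)]; omega
  · rw [if_neg (by omega), if_neg (by omega)]; omega

theorem cpos_cross (n D d k : ℤ) (hk : 0 ≤ k) (hkd : k < d) (hD : 0 ≤ D) (hn : D + d ≤ n) :
    cpos n D d k (2*D+d-1) = k ∧ cpos n D d k (2*D+d) = k := by
  unfold cpos
  rw [if_pos (by omega), if_neg (by omega)]; omega

theorem cpos_center (n D d D' d' l : ℤ) (hd : 0 < d) (hD : 0 ≤ D) (hD' : 0 ≤ D')
    (hn : D + d ≤ n) (hn' : D' + d' ≤ n)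
    (hl : 0 ≤ l) (hld : l < d') (h : D + d ≤ D' ∨ D' + d' ≤ D) :
    d ≤ cpos n D' d' l (2*D+d-1) := by
  unfold cpos; split_ifs <;> omega

theorem cpos_period (n D d k : ℤ) (hk : 0 ≤ k) (hkd : k < d) (hD : 0 ≤ D) (hn : D + d ≤ n) :
    cpos n D d k (2*n) = cpos n D d k 0 := by
  unfold cpos; rw [if_neg (by omega), if_pos (by omega)]; omega

theorem fpos_not (n D d k T : ℤ) (b : Bool) :
    fpos n D d k T (!b) = 2*n - 1 - fpos n D d k T b := by
  unfold fpos; cases b <;> by_cases h : T < 2*D+d <;> simp [h] <;> ring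

theorem fpos_bound (n D d k T : ℤ) (b : Bool) (hk : 0 ≤ k) (hkd : k < d) (hD : 0 ≤ D)
    (hn : D + d ≤ n) : 0 ≤ fpos n D d k T b ∧ fpos n D d k T b < 2*n := by
  have := cpos_bound n D d k T hk hkd hD hn
  unfold fpos; split_ifs <;> omega

theorem fpos_period (n D d k : ℤ) (b : Bool) (hk : 0 ≤ k) (hkd : k < d) (hD : 0 ≤ D)
    (hn : D + d ≤ n) : fpos n D d k (2*n) b = 2*n-1-fpos n D d k 0 b := by
  have := cpos_period n D d k hk hkd hD hn
  have h1 : ¬ (2*n < 2*D+d) := by omega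
  have h2 : (0 < 2*D+d) := by omega
  unfold fpos; rw [this]; cases b <;> simp [h1, h2] <;> ring

/-- the two trajectories `f`, `g` cross exactly once in `[0, 2n]` -/
def CrossOnce (n : ℤ) (f g : ℤ → ℤ) : Prop :=
  ∃ τ, 1 ≤ τ ∧ τ ≤ 2*n ∧
    ((∀ T, 0 ≤ T → T ≤ 2*n → (T < τ → f T < g T) ∧ (τ ≤ T → g T < f T)) ∨
     (∀ T, 0 ≤ T → T ≤ 2*n → (T < τ → g T < f T) ∧ (τ ≤ T → f T < g T)))

theorem CrossOnce.symm {n : ℤ} {f g : ℤ → ℤ} (h : CrossOnce n f g) : CrossOnce n g f := by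
  obtain ⟨τ, h1, h2, h3⟩ := h
  exact ⟨τ, h1, h2, h3.symm⟩

theorem CrossOnce.neg {n c : ℤ} {f g f' g' : ℤ → ℤ} (h : CrossOnce n f g)
    (hf : ∀ T, f' T = c - f T) (hg : ∀ T, g' T = c - g T) : CrossOnce n f' g' := by
  obtain ⟨τ, h1, h2, h3⟩ := h
  refine ⟨τ, h1, h2, ?_⟩
  rcases h3 with h3 | h3
  · right; intro T a b; have := h3 T a b; have := hf T; have := hg T; omega
  · left; intro T a b; have := h3 T a b; have := hf T; have := hg T; omega

theorem fpos_conj_cross (n D d k : ℤ) (hk : 0 ≤ k) (hkd : k < d) (hD : 0 ≤ D)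
    (hn : D + d ≤ n) :
    CrossOnce n (fun T => fpos n D d k T true) (fun T => fpos n D d k T false) := by
  refine ⟨2*D+d, by omega, by omega, Or.inr ?_⟩
  intro T h1 h2
  have := cpos_bound n D d k T hk hkd hD hn
  by_cases h : T < 2*D+d <;> simp [fpos, h] <;> omega

theorem fpos_same_cross (n D d k l : ℤ) (b : Bool) (hk : 0 ≤ k) (hkl : k < l) (hkd : l < d)
    (hD : 0 ≤ D) (hn : D + d ≤ n) :
    CrossOnce n (fun T => fpos n D d k T true) (fun T => fpos n D d l T b) := by
  refine ⟨2*D+d, by omega, by omega, ?_⟩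
  cases b
  · right
    intro T h1 h2
    have := cpos_bound n D d k T hk (by omega) hD hn
    have := cpos_bound n D d l T (by omega) (by omega) hD hn
    by_cases h : T < 2*D+d <;> simp [fpos, h] <;> omega
  · left
    intro T h1 h2
    have := cpos_same n D d k l T hk hkl hkd hD hn
    by_cases h : T < 2*D+d <;> simp [fpos, h] <;> omega

theorem fpos_diff_cross (n D d k D' d' l : ℤ) (b : Bool) (hk : 0 ≤ k) (hkd : k < d) (hD : 0 ≤ D)
    (hl : 0 ≤ l) (hld : l < d') (h : D + d ≤ D') (hn : D' + d' ≤ n) :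
    CrossOnce n (fun T => fpos n D d k T true) (fun T => fpos n D' d' l T b) := by
  have key : ∀ T, 0 ≤ T → T ≤ 2*n →
      (T < 2*D+d ∧ T < 2*D'+d' ∧ (T < D' + d' + D + k - l - n → cpos n D' d' l T < cpos n D d k T) ∧
        (D' + d' + D + k - l - n ≤ T → cpos n D d k T < cpos n D' d' l T)) ∨
      (¬ T < 2*D+d ∧ T < 2*D'+d' ∧ (T < D + d + D' + l - k → cpos n D d k T < cpos n D' d' l T) ∧
    (D + d + D' + l - k ≤ T → cpos n D' d' l T < cpos n D d k T)) ∨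
      (¬ T < 2*D+d ∧ ¬ T < 2*D'+d' ∧
       (T < D' + d' + D + k - l + n → cpos n D' d' l T < cpos n D d k T) ∧
    (D' + d' + D + k - l + n ≤ T → cpos n D d k T < cpos n D' d' l T)) := by
    intro T h1 h2
    by_cases a : T < 2*D+d
    · exact Or.inl ⟨a, by omega, cpos_lo n D d k D' d' l T hk hkd hD hl hld h hn h1 a⟩
    · by_cases a' : T < 2*D'+d'
      · exact Or.inr (Or.inl ⟨a, a',
          cpos_mid n D d k D' d' l T hk hkd hD hl hld h hn (by omega) a'⟩)
      · exact Or.inr (Or.inr ⟨a, a',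
          cpos_hi n D d k D' d' l T hk hkd hD hl hld h hn (by omega) h2⟩)
  have bd : ∀ T, 0 ≤ cpos n D d k T ∧ 0 ≤ cpos n D' d' l T := fun T =>
    ⟨(cpos_bound n D d k T hk hkd hD (by omega)).1,
     (cpos_bound n D' d' l T hl hld (by omega) hn).1⟩
  cases b
  · refine ⟨D + d + D' + l - k, by omega, by omega, Or.inr ?_⟩
    intro T h1 h2
    have := bd T
    rcases key T h1 h2 with ⟨a, a', c⟩ | ⟨a, a', c⟩ | ⟨a, a', c⟩ <;> simp [fpos, a, a'] <;> omega
  · by_cases h0 : 1 ≤ D' + d' + D + k - l - n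
    · refine ⟨D' + d' + D + k - l - n, by omega, by omega, Or.inr ?_⟩
      intro T h1 h2
      have := bd T
      rcases key T h1 h2 with ⟨a, a', c⟩ | ⟨a, a', c⟩ | ⟨a, a', c⟩ <;> simp [fpos, a, a'] <;> omega
    · refine ⟨D' + d' + D + k - l + n, by omega, by omega, Or.inl ?_⟩
      intro T h1 h2
      have := bd T
      rcases key T h1 h2 with ⟨a, a', c⟩ | ⟨a, a', c⟩ | ⟨a, a', c⟩ <;> simp [fpos, a, a'] <;> omega

/-- one move of a single point -/
theorem fpos_step (n D d k T : ℤ) (b : Bool) (hk : 0 ≤ k) (hkd : k < d) (hD : 0 ≤ D)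
    (hn : D + d ≤ n) (h1 : 1 ≤ T) (h2 : T ≤ 2*n) (hT : T ≠ 2*D+d) :
    (fpos n D d k (T-1) b < n ↔ fpos n D d k T b < n) ∧
    (fpos n D d k T b = fpos n D d k (T-1) b ∨
    (fpos n D d k T b = fpos n D d k (T-1) b + 1 ∧ (fpos n D d k (T-1) b + n + T) % 2 = 0) ∨
    (fpos n D d k T b = fpos n D d k (T-1) b - 1 ∧ (fpos n D d k (T-1) b + n + T) % 2 = 1)) := by
  have a1 := cpos_step n D d k T hk hkd hD hn h1 h2 hT
  have a2 := cpos_bound n D d k T hk hkd hD hn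
  have a3 := cpos_bound n D d k (T-1) hk hkd hD hn
  by_cases h : T < 2*D+d
  · have h' : T - 1 < 2*D+d := by omega
    cases b <;> simp only [fpos, h, h'] <;> simp <;> omega
  · have h' : ¬ (T - 1 < 2*D+d) := by omega
    cases b <;> simp only [fpos, h, h'] <;> simp <;> omega

theorem fpos_own (n D d k : ℤ) (b : Bool) (hk : 0 ≤ k) (hkd : k < d) (hD : 0 ≤ D)
    (hn : D + d ≤ n) :
    fpos n D d k (2*D+d) b = 2*n-1-fpos n D d k (2*D+d-1) b ∧
    n - d ≤ fpos n D d k (2*D+d-1) b ∧ fpos n D d k (2*D+d-1) b < n + d := by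
  have a1 := cpos_cross n D d k hk hkd hD hn
  cases b <;> simp [fpos, a1] <;> omega

theorem fpos_center (n D d D' d' l : ℤ) (b : Bool) (hd : 0 < d) (hD : 0 ≤ D) (hD' : 0 ≤ D')
    (hn : D + d ≤ n) (hn' : D' + d' ≤ n)
    (hl : 0 ≤ l) (hld : l < d') (h : D + d ≤ D' ∨ D' + d' ≤ D) :
    ¬ (n - d ≤ fpos n D' d' l (2*D+d-1) b ∧ fpos n D' d' l (2*D+d-1) b < n + d) := by
  have := cpos_center n D d D' d' l hd hD hD' hn hn' hl hld h
  unfold fpos; split_ifs <;> omega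

/-- partition of `0, …, n-1` into consecutive blocks; the block of `e` starts at `D e` and has
length `d e` -/
structure Blocks (n : ℕ) where
  D : ℕ → ℤ
  d : ℕ → ℤ
  D_nonneg : ∀ e, e < n → 0 ≤ D e
  D_le : ∀ e, e < n → D e ≤ e
  lt : ∀ e : ℕ, e < n → (e : ℤ) < D e + d e
  le_n : ∀ e, e < n → D e + d e ≤ n
  disj : ∀ e f, e < n → f < n → (D e = D f ∧ d e = d f) ∨ D e + d e ≤ D f ∨ D f + d f ≤ D e

/-- element of a point -/
def el (n p : ℕ) : ℕ := if n ≤ p then p - n else n - 1 - p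

theorem el_lt {n p : ℕ} (hp : p < 2 * n) : el n p < n := by unfold el; split_ifs <;> omega

theorem el_rev {n p : ℕ} (hp : p < 2 * n) : el n (2*n-1-p) = el n p := by
  unfold el; split_ifs <;> omega

namespace Blocks

variable {n : ℕ} (B : Blocks n)

/-- crossing time of a point -/
def M (p : ℕ) : ℤ := 2 * B.D (el n p) + B.d (el n p)

/-- position of point `p` at time `T ∈ [0, 2n]` -/
def P (T : ℤ) (p : ℕ) : ℤ :=
  fpos n (B.D (el n p)) (B.d (el n p)) (el n p - B.D (el n p)) T (decide (n ≤ p))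

theorem P_rev (T : ℤ) {p : ℕ} (hp : p < 2 * n) : B.P T (2*n-1-p) = 2*n-1-B.P T p := by
  unfold P; rw [el_rev hp, ← fpos_not]; congr 1
  by_cases h : n ≤ p
  · have : ¬ n ≤ 2*n-1-p := by omega
    simp [h, this]
  · have : n ≤ 2*n-1-p := by omega
    simp [h, this]

theorem P_bound (T : ℤ) {p : ℕ} (hp : p < 2 * n) : 0 ≤ B.P T p ∧ B.P T p < 2*n := by
  have he := el_lt hp
  have := B.D_le _ he
  have := B.lt _ he
  exact fpos_bound _ _ _ _ _ _ (by omega) (by omega) (B.D_nonneg _ he) (B.le_n _ he)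

theorem P_period {p : ℕ} (hp : p < 2 * n) : B.P (2*n) p = 2*n-1-B.P 0 p := by
  have he := el_lt hp
  have := B.D_le _ he
  have := B.lt _ he
  exact fpos_period _ _ _ _ _ (by omega) (by omega) (B.D_nonneg _ he) (B.le_n _ he)

theorem P_cross_true {p q : ℕ} (hp : p < 2 * n) (hq : q < 2 * n) (hpq : p ≠ q) (hnp : n ≤ p)
    (hle : el n p ≤ el n q) :
    CrossOnce n (fun T => B.P T p) (fun T => B.P T q) := by
  have he := el_lt hp
  have he1 := B.D_le _ he
  have he2 := B.lt _ he
  have he3 := B.D_nonneg _ he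
  have he4 := B.le_n _ he
  have hf := el_lt hq
  have hf1 := B.D_le _ hf
  have hf2 := B.lt _ hf
  have hf3 := B.D_nonneg _ hf
  have hf4 := B.le_n _ hf
  unfold P
  simp only [hnp, decide_true]
  rcases B.disj _ _ he hf with h | h | h
  · rcases hle.lt_or_eq with h' | h'
    · rw [← h.1, ← h.2]
      exact fpos_same_cross _ _ _ _ _ _ (by omega) (by omega) (by omega) he3 he4
    · have h2 : ¬ n ≤ q := by
        intro h2; unfold el at h'; split_ifs at h'; omega
      simp only [h2, decide_false, ← h']
      exact fpos_conj_cross _ _ _ _ (by omega) (by omega) he3 he4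
  · exact fpos_diff_cross _ _ _ _ _ _ _ _ (by omega) (by omega) he3 (by omega) (by omega) h hf4
  · omega

theorem P_cross {p q : ℕ} (hp : p < 2 * n) (hq : q < 2 * n) (hpq : p ≠ q) :
    CrossOnce n (fun T => B.P T p) (fun T => B.P T q) := by
  have main : ∀ p q, p < 2*n → q < 2*n → p ≠ q → el n p ≤ el n q →
      CrossOnce n (fun T => B.P T p) (fun T => B.P T q) := by
    intro p q hp hq hpq hle
    by_cases h : n ≤ p
    · exact B.P_cross_true hp hq hpq h hle
    · have := B.P_cross_true (p := 2*n-1-p) (q := 2*n-1-q) (by omega) (by omega) (by omega)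
        (by omega) (by rw [el_rev hp, el_rev hq]; exact hle)
      refine this.neg (c := 2*n-1) ?_ ?_
      · intro T; rw [B.P_rev T hp]; ring
      · intro T; rw [B.P_rev T hq]; ring
  rcases le_total (el n p) (el n q) with h | h
  · exact main p q hp hq hpq h
  · exact (main q p hq hp hpq.symm h).symm

theorem P_inj {T : ℤ} (h1 : 0 ≤ T) (h2 : T ≤ 2*n) {p q : ℕ} (hp : p < 2 * n) (hq : q < 2 * n)
    (h : B.P T p = B.P T q) : p = q := by
  by_contra hpq
  obtain ⟨τ, _, _, h3⟩ := B.P_cross hp hq hpq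
  rcases h3 with h3 | h3 <;> · have := h3 T h1 h2; simp only at this; omega

theorem P_step {T : ℤ} (h1 : 1 ≤ T) (h2 : T ≤ 2*n) {p : ℕ} (hp : p < 2 * n) (hT : T ≠ B.M p) :
    (B.P (T-1) p < n ↔ B.P T p < n) ∧
    (B.P T p = B.P (T-1) p ∨
    (B.P T p = B.P (T-1) p + 1 ∧ (B.P (T-1) p + n + T) % 2 = 0) ∨
    (B.P T p = B.P (T-1) p - 1 ∧ (B.P (T-1) p + n + T) % 2 = 1)) := by
  have he := el_lt hp
  have := B.D_le _ he
  have := B.lt _ he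
  exact fpos_step _ _ _ _ _ _ (by omega) (by omega) (B.D_nonneg _ he) (B.le_n _ he) h1 h2 hT

theorem P_own {p : ℕ} (hp : p < 2 * n) :
    B.P (B.M p) p = 2*n-1-B.P (B.M p - 1) p ∧
    n - B.d (el n p) ≤ B.P (B.M p - 1) p ∧ B.P (B.M p - 1) p < n + B.d (el n p) := by
  have he := el_lt hp
  have := B.D_le _ he
  have := B.lt _ he
  exact fpos_own _ _ _ _ _ (by omega) (by omega) (B.D_nonneg _ he) (B.le_n _ he)

/-- A point in the centre at a crossing time belongs to the crossing block -/
theorem P_center {p q : ℕ} (hp : p < 2 * n) (hq : q < 2 * n)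
    (h1 : n - B.d (el n p) ≤ B.P (B.M p - 1) q) (h2 : B.P (B.M p - 1) q < n + B.d (el n p)) :
    B.M q = B.M p ∧ B.d (el n q) = B.d (el n p) := by
  have he := el_lt hp
  have he1 := B.D_le _ he
  have he2 := B.lt _ he
  have hf := el_lt hq
  have hf1 := B.D_le _ hf
  have hf2 := B.lt _ hf
  rcases B.disj _ _ he hf with h | h
  · unfold M; rw [h.1, h.2]; exact ⟨rfl, rfl⟩
  · exfalso
    exact fpos_center n (B.D (el n p)) (B.d (el n p)) (B.D (el n q)) (B.d (el n q)) _
      (decide (n ≤ q)) (by omega) (B.D_nonneg _ he) (B.D_nonneg _ hf) (B.le_n _ he) (B.le_n _ hf)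
      (by omega) (by omega) h ⟨h1, h2⟩

theorem M_inj {p q : ℕ} (hp : p < 2 * n) (hq : q < 2 * n) (h : B.M q = B.M p) :
    B.d (el n q) = B.d (el n p) := by
  have := B.P_own hq
  rcases B.disj _ _ (el_lt hp) (el_lt hq) with h' | h'
  · exact h'.2.symm
  · have := B.D_le _ (el_lt hp)
    have := B.lt _ (el_lt hp)
    have := B.D_le _ (el_lt hq)
    have := B.lt _ (el_lt hq)
    unfold M at h
    omega

theorem M_rev {p : ℕ} (hp : p < 2 * n) : B.M (2*n-1-p) = B.M p := by
  unfold M; rw [el_rev hp]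

theorem step_aux {T : ℤ} (h1 : 1 ≤ T) (h2 : T ≤ 2*n) {p : ℕ} (hp : p < 2*n) :
    ∃ a b : ℤ, 0 ≤ a ∧ b < 2*n ∧ a ≤ B.P (T-1) p ∧ B.P (T-1) p ≤ b ∧
      ∀ q, q < 2*n → a ≤ B.P (T-1) q → B.P (T-1) q ≤ b → B.P T q = a + b - B.P (T-1) q := by
  have pb := B.P_bound (T-1) hp
  have pb' := B.P_bound T hp
  by_cases hT : T = B.M p
  · have := B.P_own hp
    have hdn := B.le_n _ (el_lt hp)
    have hdn' := B.D_nonneg _ (el_lt hp)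
    refine ⟨n - B.d (el n p), n + B.d (el n p) - 1, by omega, by omega, ?_, ?_, ?_⟩
    · rw [hT]; omega
    · rw [hT]; omega
    · intro q hq ha hb
      have := B.P_center hp hq (by rw [← hT]; exact ha) (by rw [← hT]; omega)
      have h3 := B.P_own hq
      rw [this.1, ← hT] at h3
      rw [h3.1]; ring
  · -- a neighbour cannot cross while `p` moves towards it
    have nocross : ∀ q, q < 2*n → T = B.M q → B.P T p ≠ B.P (T-1) p →
        (B.P (T-1) q = B.P T p) → False := by
      intro q hq hTq hne hqp
      have h3 := B.P_own hq
      have h4 := B.P_step h1 h2 hp hT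
      have h5 : ¬ (n - B.d (el n q) ≤ B.P (T - 1) p ∧ B.P (T - 1) p < n + B.d (el n q)) := by
        rintro ⟨h5, h6⟩
        rw [hTq] at h5 h6
        exact hT (hTq.trans (B.P_center hq hp h5 h6).1.symm)
      -- the conjugate of `q`
      have h6 := B.P_own (p := 2*n-1-q) (by omega)
      rw [B.M_rev hq, ← hTq, B.P_rev _ hq, B.P_rev _ hq] at h6
      rw [← hTq] at h3
      have h7 : B.P T (2*n-1-q) = B.P T p := by
        rw [B.P_rev _ hq]; omega
      have h8 := B.P_inj (by omega) h2 (by omega) hp h7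
      rw [← h8, B.M_rev hq] at hT
      exact hT hTq
    have h4 := B.P_step h1 h2 hp hT
    rcases h4 with ⟨-, h4 | h4 | h4⟩
    · refine ⟨B.P (T-1) p, B.P (T-1) p, by omega, by omega, le_rfl, le_rfl, ?_⟩
      intro q hq ha hb
      have := B.P_inj (T := T-1) (by omega) (by omega) hq hp (by omega)
      subst this; omega
    · refine ⟨B.P (T-1) p, B.P (T-1) p + 1, by omega, by omega, le_rfl, by omega, ?_⟩
      intro q hq ha hb
      by_cases hqp : q = p
      · subst hqp; omega
      have i1 : B.P (T-1) q ≠ B.P (T-1) p := fun h => hqp (B.P_inj (T := T-1) (by omega) (by omega) hq hp h)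
      have i2 : B.P T q ≠ B.P T p := fun h => hqp (B.P_inj (T := T) (by omega) (by omega) hq hp h)
      by_cases hTq : T = B.M q
      · exact (nocross q hq hTq (by omega) (by omega)).elim
      · have := B.P_step h1 h2 hq hTq
        omega
    · refine ⟨B.P (T-1) p - 1, B.P (T-1) p, by omega, by omega, by omega, le_rfl, ?_⟩
      intro q hq ha hb
      by_cases hqp : q = p
      · subst hqp; omega
      have i1 : B.P (T-1) q ≠ B.P (T-1) p := fun h => hqp (B.P_inj (T := T-1) (by omega) (by omega) hq hp h)
      have i2 : B.P T q ≠ B.P T p := fun h => hqp (B.P_inj (T := T) (by omega) (by omega) hq hp h)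
      by_cases hTq : T = B.M q
      · exact (nocross q hq hTq (by omega) (by omega)).elim
      · have := B.P_step h1 h2 hq hTq
        omega

end Blocks

namespace Blocks

variable {n : ℕ} (B : Blocks n)

/-- conjugate the point when `c` is odd -/
def fl (n : ℕ) (c : ℤ) (p : ℕ) : ℕ := if c % 2 = 0 then p else 2*n-1-p

theorem fl_lt {c : ℤ} {p : ℕ} (hp : p < 2*n) : fl n c p < 2*n := by
  unfold fl; split_ifs <;> omega

theorem fl_inj {c : ℤ} {p q : ℕ} (hp : p < 2*n) (hq : q < 2*n) (h : fl n c p = fl n c q) :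
    p = q := by
  unfold fl at h; split_ifs at h <;> omega

/-- position at arbitrary time -/
def PT (T : ℤ) (p : ℕ) : ℤ := B.P (T % (2*n)) (fl n (T / (2*n)) p)

theorem PT_bound (T : ℤ) {p : ℕ} (hp : p < 2*n) : 0 ≤ B.PT T p ∧ B.PT T p < 2*n :=
  B.P_bound _ (fl_lt hp)

theorem PT_inj (T : ℤ) {p q : ℕ} (hp : p < 2*n) (hq : q < 2*n) (h : B.PT T p = B.PT T q) :
    p = q := by
  have h1 := Int.emod_nonneg T (b := 2*n) (by omega)
  have h2 := Int.emod_lt_of_pos T (b := 2*n) (by omega)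
  exact fl_inj hp hq (B.P_inj h1 (by omega) (fl_lt hp) (fl_lt hq) h)

theorem PT_rev (T : ℤ) {p : ℕ} (hp : p < 2*n) : B.PT T (2*n-1-p) = 2*n-1-B.PT T p := by
  unfold PT
  rw [← B.P_rev _ (fl_lt hp)]
  congr 1
  unfold fl; split_ifs <;> omega

theorem PT_of_eq (c r : ℤ) (h1 : 0 ≤ r) (h2 : r ≤ 2*n) {p : ℕ} (hp : p < 2*n) :
    B.PT (2*n*c + r) p = B.P r (fl n c p) := by
  unfold PT
  rcases h2.lt_or_eq with h | h
  · rw [Int.mul_add_emod_self_left, Int.emod_eq_of_lt h1 h, Int.mul_add_ediv_left _ _ (by omega),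
      Int.ediv_eq_zero_of_lt h1 h, add_zero]
  · have h3 : 2*n*c + r = 2*n*(c+1) + 0 := by rw [h]; ring
    rw [h3, Int.mul_add_emod_self_left, Int.mul_add_ediv_left _ _ (by omega), h,
      B.P_period (fl_lt hp), ← B.P_rev _ (fl_lt hp)]
    simp only [Int.zero_emod, Int.zero_ediv, add_zero]
    congr 1
    unfold fl; split_ifs <;> omega

/-- every move is a move of the first halfperiod, up to conjugation -/
theorem PT_local (hn : 0 < n) (i : ℤ) : ∃ c r : ℤ, 1 ≤ r ∧ r ≤ 2*n ∧ i = 2*n*c + r ∧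
    ∀ p, p < 2*n → B.PT (i-1) p = B.P (r-1) (fl n c p) ∧ B.PT i p = B.P r (fl n c p) := by
  have h1 := Int.emod_nonneg (i-1) (b := 2*n) (by omega)
  have h2 := Int.emod_lt_of_pos (i-1) (b := 2*n) (by omega)
  have h3 := Int.mul_ediv_add_emod (i-1) (2*n)
  refine ⟨(i-1)/(2*n), (i-1)%(2*n)+1, by omega, by omega, by omega, ?_⟩
  intro p hp
  rw [← B.PT_of_eq _ _ (by omega) (by omega) hp, ← B.PT_of_eq _ _ (by omega) (by omega) hp]
  constructor <;> congr 1 <;> omega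

theorem PT_first {i : ℤ} (h1 : 0 ≤ i) (h2 : i ≤ 2*n) {p : ℕ} (hp : p < 2*n) :
    B.PT i p = B.P i p := by
  have := B.PT_of_eq 0 i h1 h2 hp
  simpa [fl] using this

/-- the permutation at time `T` -/
noncomputable def perm (T : ℤ) : Fin (2*n) ≃ Fin (2*n) :=
  Equiv.ofBijective
    (fun p => ⟨(B.PT T p).toNat, by have := B.PT_bound T p.2; omega⟩ : Fin (2*n) → Fin (2*n))
    (Finite.injective_iff_bijective.mp (by
      intro p q h
      have h' : (B.PT T p).toNat = (B.PT T q).toNat := congrArg Fin.val h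
      have := B.PT_bound T p.2
      have := B.PT_bound T q.2
      exact Fin.ext (B.PT_inj T p.2 q.2 (by omega))))

theorem perm_val (T : ℤ) (p : Fin (2*n)) : ((B.perm T p : ℕ) : ℤ) = B.PT T p := by
  have := B.PT_bound T p.2
  change (((B.PT T p).toNat : ℕ) : ℤ) = _
  omega

/-- the allowable sequence -/
noncomputable def seq (hn : 0 < n) : AllowableSeq (2*n) where
  perm := B.perm
  h := 2*n
  h_pos := by omega
  reversal := by
    intro i p
    have h1 := B.perm_val (i + (2*n : ℕ)) p
    have h2 := B.perm_val i p
    obtain ⟨c, r, hr1, hr2, hi, hloc⟩ := B.PT_local hn i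
    have h3 := B.PT_of_eq (c+1) r (by omega) hr2 p.2
    have h4 := (hloc p p.2).2
    have h5 : 2*n*(c+1) + r = i + (2*n : ℕ) := by rw [hi]; push_cast; ring
    have h6 : fl n (c+1) p = 2*n-1-fl n c p := by
      unfold fl; split_ifs <;> omega
    rw [h6, B.P_rev _ (fl_lt p.2), ← h4, h5] at h3
    omega
  step := by
    intro i j
    obtain ⟨c, r, hr1, hr2, hi, hloc⟩ := B.PT_local hn i
    obtain ⟨p, rfl⟩ := (B.perm (i-1)).surjective j
    obtain ⟨a, b, ha, hb, hap, hpb, hq⟩ := B.step_aux hr1 hr2 (fl_lt (c := c) p.2)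
    have h1 := B.perm_val (i-1) p
    have h2 := hloc p p.2
    refine ⟨a.toNat, b.toNat, by omega, by omega, by omega, ?_⟩
    intro q hq1 hq2
    have h3 := B.perm_val (i-1) q
    have h3' := B.perm_val i q
    have h4 := hloc q q.2
    have h5 := hq _ (fl_lt (c := c) q.2) (by omega) (by omega)
    omega
  flip_once := by
    intro p q hpq
    obtain ⟨τ, hτ1, hτ2, h⟩ := B.P_cross p.2 q.2 (fun h => hpq (Fin.ext h))
    have val : ∀ i : ℤ, 0 ≤ i → i ≤ 2*n → (B.perm i p < B.perm i q ↔ B.P i p < B.P i q) := by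
      intro i h1 h2
      rw [← B.PT_first h1 h2 p.2, ← B.PT_first h1 h2 q.2, ← B.perm_val, ← B.perm_val, Fin.lt_def]
      omega
    have key : ∀ i : ℤ, 1 ≤ i → i ≤ 2*n →
        (¬ ((B.perm (i-1) p < B.perm (i-1) q) ↔ (B.perm i p < B.perm i q)) ↔ i = τ) := by
      intro i h1 h2
      rw [val i (by omega) h2, val (i-1) (by omega) (by omega)]
      rcases h with h | h
      · have a1 := h i (by omega) h2
        have a2 := h (i-1) (by omega) (by omega)
        simp only at a1 a2
        omega
      · have a1 := h i (by omega) h2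
        have a2 := h (i-1) (by omega) (by omega)
        simp only at a1 a2
        omega
    refine ⟨τ, ⟨Finset.mem_Icc.mpr ⟨hτ1, by push_cast; exact hτ2⟩, (key τ hτ1 hτ2).mpr rfl⟩, ?_⟩
    rintro i ⟨hi, hf⟩
    rw [Finset.mem_Icc] at hi
    push_cast at hi
    exact (key i hi.1 hi.2).mp hf

theorem centSym (hn : 0 < n) : CentSym (B.seq hn) (fun p => Fin.rev p) := by
  intro i p
  change (B.perm i p : ℕ) + (B.perm i (Fin.rev p) : ℕ) = 2*n-1
  have h1 := B.perm_val i p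
  have h2 := B.perm_val i (Fin.rev p)
  have h3 : ((Fin.rev p : Fin (2*n)) : ℕ) = 2*n-1-p := by rw [Fin.val_rev]; omega
  rw [h3, B.PT_rev _ p.2] at h2
  omega

theorem crossingAt (hn : 0 < n) (i c r : ℤ) (hr1 : 1 ≤ r) (hr2 : r ≤ 2*n)
    (hloc : ∀ p, p < 2*n → B.PT (i-1) p = B.P (r-1) (fl n c p) ∧ B.PT i p = B.P r (fl n c p))
    (p : ℕ) (hp : p < 2*n) (hM : r = B.M p) (e : ℕ) (he : B.d (el n p) = e) :
    CrossingAt n (B.seq hn) i e := by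
  have hown := B.P_own hp
  have e1 := B.D_nonneg _ (el_lt hp)
  have e2 := B.D_le _ (el_lt hp)
  have e3 := B.lt _ (el_lt hp)
  have e4 := B.le_n _ (el_lt hp)
  refine ⟨by omega, by omega, ?_, ?_⟩
  · intro q h1 h2
    change n - e ≤ (B.perm (i-1) q : ℕ) at h1
    change (B.perm (i-1) q : ℕ) < n + e at h2
    change (B.perm i q : ℕ) = 2*n-1-(B.perm (i-1) q : ℕ)
    have v1 := B.perm_val (i-1) q
    have v2 := B.perm_val i q
    have hl := hloc q q.2
    have hc := B.P_center hp (fl_lt (c := c) q.2) (by rw [← hM]; omega) (by rw [← hM]; omega)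
    have ho := B.P_own (fl_lt (c := c) q.2)
    rw [hc.1, ← hM] at ho
    omega
  · by_cases hen : e = n
    · exact Or.inl hen
    right
    intro q h1 h2
    change (B.perm (i-1) q : ℕ) = n - e - 1 at h1
    change (B.perm i q : ℕ) = n + e at h2
    have v1 := B.perm_val (i-1) q
    have v2 := B.perm_val i q
    have hl := hloc q q.2
    by_cases hq : r = B.M (fl n c q)
    · have ho := B.P_own (fl_lt (c := c) q.2)
      have hd := B.M_inj hp (fl_lt (c := c) q.2) (by rw [← hq, hM])
      rw [← hq] at ho
      omega
    · have hs := B.P_step hr1 hr2 (fl_lt (c := c) q.2) hq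
      omega

theorem noncentral (hn : 0 < n) : NoncentralGenPos n (B.seq hn) := by
  intro i p hne
  change (B.perm i p : ℕ) ≠ (B.perm (i-1) p : ℕ) at hne
  change ((B.perm i p : ℕ) + 1 = (B.perm (i-1) p : ℕ) ∨
    (B.perm (i-1) p : ℕ) + 1 = (B.perm i p : ℕ)) ∨ ∃ e, CrossingAt n (B.seq hn) i e ∧
      n - e ≤ (B.perm (i-1) p : ℕ) ∧ (B.perm (i-1) p : ℕ) < n + e
  have v1 := B.perm_val (i-1) p
  have v2 := B.perm_val i p
  obtain ⟨c, r, hr1, hr2, hi, hloc⟩ := B.PT_local hn i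
  have hl := hloc p p.2
  by_cases hq : r = B.M (fl n c p)
  · right
    have hlt := fl_lt (c := c) p.2
    have e2 := B.D_le _ (el_lt hlt)
    have e3 := B.lt _ (el_lt hlt)
    have ho := B.P_own hlt
    rw [← hq] at ho
    refine ⟨(B.d (el n (fl n c p))).toNat,
      B.crossingAt hn i c r hr1 hr2 hloc (fl n c p) hlt hq _ (by omega), by omega, by omega⟩
  · left
    have hs := B.P_step hr1 hr2 (fl_lt (c := c) p.2) hq
    omega

theorem signature (hn : 0 < n) (t : ℕ) (d : Fin t → ℕ) (m : Fin t → ℤ) (hm : StrictMono m)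
    (h1 : ∀ i, ∃ e, e < n ∧ m i = 2 * B.D e + B.d e ∧ B.d e = d i)
    (h2 : ∀ e, e < n → ∃ i, 2 * B.D e + B.d e = m i) :
    HasCentralSignature n t (B.seq hn) d m := by
  have hel : ∀ e, e < n → el n (n + e) = e := by intro e he; simp [el]
  have hmem : ∀ i, 1 ≤ m i ∧ m i ≤ 2*n := by
    intro i
    obtain ⟨e, he, hm1, -⟩ := h1 i
    have e1 := B.D_nonneg _ he
    have e2 := B.D_le _ he
    have e3 := B.lt _ he
    have e4 := B.le_n _ he
    omega
  have hfirst : ∀ i : ℤ, 1 ≤ i → i ≤ 2*n → ∀ p, p < 2*n →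
      B.PT (i-1) p = B.P (i-1) (fl n 0 p) ∧ B.PT i p = B.P i (fl n 0 p) := by
    intro i a b p hp
    exact ⟨by rw [B.PT_first (by omega) (by omega) hp]; simp [fl],
      by rw [B.PT_first (by omega) (by omega) hp]; simp [fl]⟩
  refine ⟨hm, fun i => Finset.mem_Icc.mpr (hmem i), ?_, ?_⟩
  · intro i
    obtain ⟨e, he, hm1, hm2⟩ := h1 i
    refine B.crossingAt hn (m i) 0 (m i) (hmem i).1 (hmem i).2
      (hfirst _ (hmem i).1 (hmem i).2) (n + e) (by omega) ?_ _ ?_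
    · unfold M; rw [hel e he]; exact hm1
    · rw [hel e he]; exact hm2
  · intro j hj hjm e hc
    rw [Finset.mem_Icc] at hj
    obtain ⟨he1, he2, hc, -⟩ := hc
    obtain ⟨p, hp⟩ := (B.perm (j-1)).surjective ⟨n-1, by omega⟩
    have hp' : (B.perm (j-1) p : ℕ) = n - 1 := congrArg Fin.val hp
    have h3 : (B.perm j p : ℕ) = 2*n-1-(B.perm (j-1) p : ℕ) :=
      hc p (show n - e ≤ (B.perm (j-1) p : ℕ) by omega) (show (B.perm (j-1) p : ℕ) < n + e by omega)
    have v1 := B.perm_val (j-1) p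
    have v2 := B.perm_val j p
    rw [B.PT_first (by omega) (by omega) p.2] at v1 v2
    have hs := B.P_step hj.1 hj.2 p.2 (by
      obtain ⟨i, hi⟩ := h2 _ (el_lt p.2)
      intro h
      exact hjm i (h.trans hi))
    omega

end Blocks

/-- prefix sums -/
def pre (t : ℕ) (d : Fin t → ℕ) (k : ℕ) : ℕ :=
  ∑ j ∈ Finset.range k, if h : j < t then d ⟨j, h⟩ else 0

theorem pre_succ (t : ℕ) (d : Fin t → ℕ) (i : Fin t) : pre t d (i+1) = pre t d i + d i := by
  unfold pre; rw [Finset.sum_range_succ]; simp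

theorem pre_mono (t : ℕ) (d : Fin t → ℕ) : Monotone (pre t d) := by
  apply monotone_nat_of_le_succ
  intro k; unfold pre; rw [Finset.sum_range_succ]; omega

theorem pre_t (t : ℕ) (d : Fin t → ℕ) : pre t d t = ∑ i, d i := by
  unfold pre; rw [Finset.sum_range]; simp

theorem pre_exists (t : ℕ) (d : Fin t → ℕ) (e : ℕ) (he : e < ∑ i, d i) :
    ∃ i : Fin t, pre t d i ≤ e ∧ e < pre t d i + d i := by
  have : ∀ k, k ≤ t → e < pre t d k → ∃ i : Fin t, pre t d i ≤ e ∧ e < pre t d i + d i := by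
    intro k
    induction k with
    | zero => intro _ h; simp [pre] at h
    | succ k ih =>
      intro hk h
      by_cases h' : e < pre t d k
      · exact ih (by omega) h'
      · have := pre_succ t d ⟨k, hk⟩
        simp only at this
        exact ⟨⟨k, hk⟩, by simp only; omega, by simp only; omega⟩
  exact this t le_rfl (by rw [pre_t]; exact he)

/-- Every sequence `(d 0, …, d (t-1))` of positive integers with `t ≥ 2` is the central
signature of some even-near-critical centrally symmetric allowable sequence in
noncentral general position (on `2n` points, `n = ∑ d i`, halfperiod length `2n`). -/
theorem stmt_11 (t : ℕ) (ht : 2 ≤ t) (d : Fin t → ℕ) (hd : ∀ i, 1 ≤ d i) :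
    ∃ (A : AllowableSeq (2 * ∑ i, d i)) (conj : Fin (2 * ∑ i, d i) → Fin (2 * ∑ i, d i))
      (m : Fin t → ℤ),
      A.h = 2 * ∑ i, d i ∧ CentSym A conj ∧ NoncentralGenPos (∑ i, d i) A ∧
      HasCentralSignature (∑ i, d i) t A d m := by
  have sep : ∀ i j : Fin t, i < j → pre t d i + d i ≤ pre t d j := by
    intro i j hij
    rw [← pre_succ]
    exact pre_mono t d (Nat.succ_le_of_lt hij)
  have top : ∀ i : Fin t, pre t d i + d i ≤ ∑ i, d i := by
    intro i
    rw [← pre_succ, ← pre_t]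
    exact pre_mono t d i.2
  have hex : ∀ e : ℕ, ∃ i : Fin t, e < ∑ i, d i → pre t d i ≤ e ∧ e < pre t d i + d i := by
    intro e
    by_cases he : e < ∑ i, d i
    · obtain ⟨i, hi⟩ := pre_exists t d e he
      exact ⟨i, fun _ => hi⟩
    · exact ⟨⟨0, by omega⟩, fun h => absurd h he⟩
  choose g hg using hex
  let B : Blocks (∑ i, d i) :=
    { D := fun e => (pre t d (g e) : ℤ)
      d := fun e => (d (g e) : ℤ)
      D_nonneg := fun e _ => by positivity
      D_le := fun e he => by have := hg e he; omega
      lt := fun e he => by have := hg e he; omega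
      le_n := fun e he => by have := top (g e); exact_mod_cast this
      disj := fun e f _ _ => by
        rcases lt_trichotomy (g e) (g f) with h | h | h
        · have := sep _ _ h; omega
        · left; simp [h]
        · have := sep _ _ h; omega }
  have hn : 0 < ∑ i, d i := by
    have := top ⟨0, by omega⟩
    have := hd ⟨0, by omega⟩
    omega
  refine ⟨B.seq hn, fun p => Fin.rev p, fun i => 2 * (pre t d i : ℤ) + d i, rfl, B.centSym hn,
    B.noncentral hn, B.signature hn t d _ ?_ ?_ ?_⟩
  · intro i j hij
    have := sep i j hij
    have := hd i
    have := hd j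
    simp only
    omega
  · intro i
    have h1 := top i
    have h2 := hd i
    have h3 : pre t d i < ∑ i, d i := by omega
    have h4 := hg _ h3
    have h5 : g (pre t d i) = i := by
      rcases lt_trichotomy (g (pre t d i)) i with h | h | h
      · have := sep _ _ h; omega
      · exact h
      · have := sep _ _ h; omega
    refine ⟨pre t d i, h3, ?_, ?_⟩
    · change _ = 2 * (pre t d (g (pre t d i)) : ℤ) + d (g (pre t d i))
      rw [h5]
    · change (d (g (pre t d i)) : ℤ) = _
      rw [h5]
  · intro e _
    exact ⟨g e, rfl⟩
end
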